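/- arXiv:2207.03354 — 2 statements merged into one kernel-verified Lean document; each statement's English description precedes it below -/
import Mathlib

section
/- Let k ≤ n be nonnegative integers and let μ ⊆ λ be strict partitions with ℓ(λ) ≤ n. Then in ℚ[x₁^{±1},…,x_k^{±1}][x_{k+1},…,xₙ] one has Σ_{T ∈ QT^{(k,n−k)}(λ/μ)} x^T = Σ_ν ( Σ_{T_C ∈ QT^{(k,0)}(ν/μ)} x^{T_C} ) · ( Σ_{T_A} x^{T_A} ), where ν runs over all strict partitions with μ ⊆ ν ⊆ λ; QT^{(k,0)}(ν/μ) is the set of tableaux of shape S(ν/μ) over the sub-alphabet 1′<1<1̄′<1̄<⋯<k′<k<k̄′<k̄ satisfying (QT1)–(QT5); and the inner second sum is over fillings T_A of S(λ/ν) with letters from the totally ordered alphabet (k+1)′<k+1<(k+2)′<k+2<⋯<n′<n satisfying (QT1)–(QT4), weighted by x^{T_A} := Π_{j=k+1}^n x_j^{m(j′)+m(j)}. -/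
open MvPolynomial

noncomputable section

abbrev SymF : Type := MvPolynomial ℕ ℚ

/-- A partition, as a weakly decreasing function `ℕ → ℕ` (0-indexed parts)
that eventually vanishes. -/
structure Partn where
  part : ℕ → ℕ
  antitone' : ∀ i, part (i + 1) ≤ part i
  exists_zero : ∃ N, part N = 0

/-- The length (number of nonzero parts) of a partition. -/
def Partn.len (l : Partn) : ℕ := Nat.find l.exists_zero

/-- Containment of partitions (of their Young diagrams). -/
def Partn.Sub (mu lam : Partn) : Prop := ∀ i, mu.part i ≤ lam.part i

/-- The empty partition. -/
def Partn.empty : Partn := ⟨fun _ => 0, fun _ => le_rfl, ⟨0, rfl⟩⟩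

/-- A strict partition: strictly decreasing positive parts. -/
structure SPartn where
  part : ℕ → ℕ
  strict' : ∀ i, part (i + 1) ≠ 0 → part (i + 1) < part i
  exists_zero : ∃ N, part N = 0

/-- The length (number of nonzero parts) of a strict partition. -/
def SPartn.len (l : SPartn) : ℕ := Nat.find l.exists_zero

/-- Containment of strict partitions. -/
def SPartn.Sub (mu lam : SPartn) : Prop := ∀ i, mu.part i ≤ lam.part i

/-- The empty strict partition. -/
def SPartn.empty : SPartn := ⟨fun _ => 0, fun _ h => absurd rfl h, ⟨0, rfl⟩⟩

/-- The one-row strict partition `(a)`. -/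
def SPartn.single (a : ℕ) : SPartn :=
  ⟨fun i => if i = 0 then a else 0,
   fun i h => absurd (if_neg (Nat.succ_ne_zero i)) h, ⟨1, rfl⟩⟩

/-- The two-row strict partition `(a, b)` with `b < a` (allowing `b = 0`). -/
def SPartn.two (a b : ℕ) (h : b < a) : SPartn :=
  ⟨fun i => if i = 0 then a else if i = 1 then b else 0,
   by
    intro i hi
    match i with
    | 0 => simpa using h
    | (n+1) => simp at hi,
   ⟨2, rfl⟩⟩

/-- Parts of a strict partition are strictly decreasing within its length. -/
theorem SPartn.part_lt (s : SPartn) {i j : ℕ} (hij : i < j) (hj : j < s.len) :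
    s.part j < s.part i := by
  have hjne : s.part j ≠ 0 := Nat.find_min s.exists_zero hj
  have key : ∀ d i, s.part (i + d + 1) ≠ 0 → s.part (i + d + 1) < s.part i := by
    intro d
    induction d with
    | zero => intro i hI; simpa using s.strict' i (by simpa using hI)
    | succ d ih =>
      intro i hI
      have h1 : s.part (i + d + 1 + 1) < s.part (i + d + 1) := s.strict' (i + d + 1) hI
      have h2 : s.part (i + d + 1) ≠ 0 := by omega
      exact lt_trans h1 (ih i h2)
  have hj' : i + (j - i - 1) + 1 = j := by omega
  rw [← hj'] at hjne ⊢
  exact key _ i hjne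


/-- Laurent polynomials in `k` variables. -/
abbrev Laur (k : ℕ) : Type := AddMonoidAlgebra ℚ (Fin k →₀ ℤ)

/-- The Laurent monomial `x_i ^ z`. -/
def lX {k : ℕ} (i : Fin k) (z : ℤ) : Laur k :=
  AddMonoidAlgebra.single (Finsupp.single i z) 1

/-- `ℚ[x₁^{±1},…,x_k^{±1}][x_{k+1},…,xₙ]` (with `m = n − k` type-`A` variables). -/
abbrev IRing (k m : ℕ) : Type := MvPolynomial (Fin m) (Laur k)

/-- The shifted skew diagram `S(λ/μ) = S(λ) ∖ S(μ)` of strict partitions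
`μ ⊆ λ`, as 0-indexed cells: `i < ℓ(λ)` and `μ_i + i ≤ j < λ_i + i`. -/
def sdiag (lam mu : SPartn) : Finset (ℕ × ℕ) :=
  (Finset.range lam.len ×ˢ Finset.range (lam.len + lam.part 0)).filter
    fun c => mu.part c.1 + c.1 ≤ c.2 ∧ c.2 < lam.part c.1 + c.1

/-
Coding of the primed alphabet
`1′ < 1 < 1̄′ < 1̄ < ⋯ < k′ < k < k̄′ < k̄ < (k+1)′ < k+1 < ⋯ < n′ < n`
by `Fin (2(n+k))`:
`i′ ↦ 4i−4`, `i ↦ 4i−3`, `ī′ ↦ 4i−2`, `ī ↦ 4i−1` for `1 ≤ i ≤ k`, and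
`j′ ↦ 4k+2(j−k−1)`, `j ↦ 4k+2(j−k−1)+1` for `k+1 ≤ j ≤ n`.
A letter is primed exactly when its code is even.
-/

/-- `T` is an intermediate symplectic primed shifted tableau of shape `S(λ/μ)`:
(QT1) rows weakly increase; (QT2) columns weakly increase;
(QT3) each row contains each primed letter at most once;
(QT4) each column contains each unprimed letter at most once;
(QT5) a diagonal entry `T(i,i)` (`1 ≤ i ≤ k`) that is `≤ k̄` lies in `{i′, i, ī′, ī}`. -/
def IsQT (k : ℕ) {n : ℕ} {lam mu : SPartn}
    (T : {c // c ∈ sdiag lam mu} → Fin (2 * (n + k))) : Prop :=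
  (∀ c c' : {c // c ∈ sdiag lam mu},
      c.1.1 = c'.1.1 → c.1.2 ≤ c'.1.2 → T c ≤ T c') ∧
  (∀ c c' : {c // c ∈ sdiag lam mu},
      c.1.2 = c'.1.2 → c.1.1 ≤ c'.1.1 → T c ≤ T c') ∧
  (∀ c c' : {c // c ∈ sdiag lam mu},
      c.1.1 = c'.1.1 → T c = T c' → Even (T c : ℕ) → c = c') ∧
  (∀ c c' : {c // c ∈ sdiag lam mu},
      c.1.2 = c'.1.2 → T c = T c' → ¬ Even (T c : ℕ) → c = c') ∧
  (∀ c : {c // c ∈ sdiag lam mu},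
      c.1.1 = c.1.2 → c.1.1 < k → (T c : ℕ) < 4 * k →
        4 * c.1.1 ≤ (T c : ℕ) ∧ (T c : ℕ) < 4 * c.1.1 + 4)

/-- `T` is a primed shifted tableau over a purely type-`A` primed alphabet
`(k+1)′ < k+1 < ⋯ < n′ < n` (coded by `Fin (2(n−k))`, a letter being primed
exactly when its code is even), satisfying (QT1)–(QT4). -/
def IsQTA {A : ℕ} {lam mu : SPartn}
    (T : {c // c ∈ sdiag lam mu} → Fin A) : Prop :=
  (∀ c c' : {c // c ∈ sdiag lam mu},
      c.1.1 = c'.1.1 → c.1.2 ≤ c'.1.2 → T c ≤ T c') ∧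
  (∀ c c' : {c // c ∈ sdiag lam mu},
      c.1.2 = c'.1.2 → c.1.1 ≤ c'.1.1 → T c ≤ T c') ∧
  (∀ c c' : {c // c ∈ sdiag lam mu},
      c.1.1 = c'.1.1 → T c = T c' → Even (T c : ℕ) → c = c') ∧
  (∀ c c' : {c // c ∈ sdiag lam mu},
      c.1.2 = c'.1.2 → T c = T c' → ¬ Even (T c : ℕ) → c = c')

open scoped Classical in
/-- The multiplicity `m(γ)` of the letter with code `v` in the filling `T`. -/
def cnt {D : Finset (ℕ × ℕ)} {A : ℕ} (T : {c // c ∈ D} → Fin A) (v : ℕ) : ℕ :=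
  (Finset.univ.filter fun c : {c // c ∈ D} => (T c : ℕ) = v).card

/-- The weight `x^T = Π_{i=1}^k x_i^{m(i′)+m(i)−m(ī′)−m(ī)} Π_{j=k+1}^n x_j^{m(j′)+m(j)}`
of an intermediate symplectic primed shifted tableau. -/
def qtWeight (k n : ℕ) {lam mu : SPartn}
    (T : {c // c ∈ sdiag lam mu} → Fin (2 * (n + k))) : IRing k (n - k) :=
  (∏ i : Fin k,
      MvPolynomial.C (lX i
        (((cnt T (4 * i) : ℤ) + (cnt T (4 * i + 1) : ℤ))
          - (cnt T (4 * i + 2) : ℤ) - (cnt T (4 * i + 3) : ℤ)))) *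
  ∏ j : Fin (n - k),
    MvPolynomial.X j ^ (cnt T (4 * k + 2 * (j : ℕ)) + cnt T (4 * k + 2 * (j : ℕ) + 1))

/-- The weight in `ℚ[x₁^{±1},…,x_k^{±1}]` of a `(k,0)` primed shifted tableau. -/
def qtWeightC (k : ℕ) {lam mu : SPartn}
    (T : {c // c ∈ sdiag lam mu} → Fin (2 * (k + k))) : Laur k :=
  ∏ i : Fin k,
    lX i (((cnt T (4 * i) : ℤ) + (cnt T (4 * i + 1) : ℤ))
      - (cnt T (4 * i + 2) : ℤ) - (cnt T (4 * i + 3) : ℤ))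

/-- The weight `Π_{j=k+1}^n x_j^{m(j′)+m(j)}` of a primed shifted tableau over
the type-`A` alphabet `(k+1)′ < k+1 < ⋯ < n′ < n` coded by `Fin (2(n−k))`. -/
def qtWeightA (k n : ℕ) {lam mu : SPartn}
    (T : {c // c ∈ sdiag lam mu} → Fin (2 * (n - k))) : IRing k (n - k) :=
  ∏ j : Fin (n - k),
    MvPolynomial.X j ^ (cnt T (2 * (j : ℕ)) + cnt T (2 * (j : ℕ) + 1))

theorem SPartn.part_step (s : SPartn) (i : ℕ) : s.part (i + 1) ≤ s.part i := by
  by_cases h : s.part (i + 1) = 0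
  · omega
  · exact (s.strict' i h).le

theorem SPartn.part_anti (s : SPartn) : Antitone s.part := antitone_nat_of_succ_le s.part_step

theorem SPartn.lt_len (s : SPartn) {i : ℕ} (h : 0 < s.part i) : i < s.len := by
  by_contra hc
  have h1 : s.part s.len = 0 := Nat.find_spec s.exists_zero
  have := s.part_anti (not_lt.mp hc)
  omega

theorem SPartn.ext_part {a b : SPartn} (h : ∀ i, a.part i = b.part i) : a = b := by
  cases a; cases b
  congr
  exact funext h

theorem mem_sdiag (lam mu : SPartn) (i j : ℕ) :
    (i, j) ∈ sdiag lam mu ↔ mu.part i + i ≤ j ∧ j < lam.part i + i := by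
  simp only [sdiag, Finset.mem_filter, Finset.mem_product, Finset.mem_range]
  constructor
  · exact fun h => h.2
  · intro h
    have h1 : i < lam.len := lam.lt_len (by omega)
    have h2 := lam.part_anti (Nat.zero_le i)
    exact ⟨⟨h1, by omega⟩, h⟩

/-- If `(i', j)` with `i ≤ i'`, `i' ≤ j` lies in `S(ν)` then so does `(i, j)`. -/
theorem SPartn.col_down (s : SPartn) {i i' j : ℕ} (h : i ≤ i') (hj : i' ≤ j)
    (h2 : j < s.part i' + i') : j < s.part i + i := by
  induction i', h using Nat.le_induction with
  | base => exact h2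
  | succ m hm ih =>
    apply ih (by omega)
    have := s.strict' m (by omega)
    omega

/-- `T` is obtained by gluing `TC` and `TA`. -/
def Glued {k n : ℕ} {lam mu ν : SPartn} (T : {c // c ∈ sdiag lam mu} → Fin (2 * (n + k)))
    (TC : {c // c ∈ sdiag ν mu} → Fin (2 * (k + k)))
    (TA : {c // c ∈ sdiag lam ν} → Fin (2 * (n - k))) : Prop :=
  (∀ c (h : c ∈ sdiag lam mu) (h' : c ∈ sdiag ν mu), (T ⟨c, h⟩ : ℕ) = TC ⟨c, h'⟩) ∧
  (∀ c (h : c ∈ sdiag lam mu) (h' : c ∈ sdiag lam ν), (T ⟨c, h⟩ : ℕ) = 4 * k + TA ⟨c, h'⟩)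

section
variable {k n : ℕ} {lam mu ν : SPartn}

theorem sdiag_left (h2 : ν.Sub lam) {c : ℕ × ℕ} (h : c ∈ sdiag ν mu) : c ∈ sdiag lam mu := by
  obtain ⟨i, j⟩ := c
  rw [mem_sdiag] at *
  have := h2 i
  omega

theorem sdiag_right (h1 : mu.Sub ν) {c : ℕ × ℕ} (h : c ∈ sdiag lam ν) : c ∈ sdiag lam mu := by
  obtain ⟨i, j⟩ := c
  rw [mem_sdiag] at *
  have := h1 i
  omega

theorem sdiag_or {c : ℕ × ℕ} (h : c ∈ sdiag lam mu) : c ∈ sdiag ν mu ∨ c ∈ sdiag lam ν := by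
  obtain ⟨i, j⟩ := c
  simp only [mem_sdiag] at *
  omega

theorem Glued.lt_iff {T : {c // c ∈ sdiag lam mu} → Fin (2 * (n + k))}
    {TC : {c // c ∈ sdiag ν mu} → Fin (2 * (k + k))}
    {TA : {c // c ∈ sdiag lam ν} → Fin (2 * (n - k))} (g : Glued T TC TA)
    {c : ℕ × ℕ} (h : c ∈ sdiag lam mu) : (T ⟨c, h⟩ : ℕ) < 4 * k ↔ c ∈ sdiag ν mu := by
  constructor
  · intro hlt
    rcases sdiag_or (ν := ν) h with h' | h'
    · exact h'
    · have := g.2 c h h'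
      omega
  · intro h'
    have := g.1 c h h'
    have := (TC ⟨c, h'⟩).2
    omega

theorem Glued.isQT (h1 : mu.Sub ν) (h2 : ν.Sub lam)
    {T : {c // c ∈ sdiag lam mu} → Fin (2 * (n + k))}
    {TC : {c // c ∈ sdiag ν mu} → Fin (2 * (k + k))}
    {TA : {c // c ∈ sdiag lam ν} → Fin (2 * (n - k))} (g : Glued T TC TA) :
    IsQT k T ↔ IsQT k TC ∧ IsQTA TA := by
  have ev : ∀ m, Even (4 * k + m) ↔ Even m := by
    intro m; rw [Nat.even_add]
    simp [show Even (4 * k) from ⟨2 * k, by ring⟩]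
  constructor
  · rintro ⟨q1, q2, q3, q4, q5⟩
    refine ⟨⟨?_, ?_, ?_, ?_, ?_⟩, ?_, ?_, ?_, ?_⟩
    · rintro ⟨c, hc⟩ ⟨c', hc'⟩ e l
      have := q1 ⟨c, sdiag_left h2 hc⟩ ⟨c', sdiag_left h2 hc'⟩ e l
      rw [Fin.le_def] at *
      rwa [g.1 c _ hc, g.1 c' _ hc'] at this
    · rintro ⟨c, hc⟩ ⟨c', hc'⟩ e l
      have := q2 ⟨c, sdiag_left h2 hc⟩ ⟨c', sdiag_left h2 hc'⟩ e l
      rw [Fin.le_def] at *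
      rwa [g.1 c _ hc, g.1 c' _ hc'] at this
    · rintro ⟨c, hc⟩ ⟨c', hc'⟩ e l p
      have := q3 ⟨c, sdiag_left h2 hc⟩ ⟨c', sdiag_left h2 hc'⟩ e
      rw [Fin.ext_iff] at *
      rw [g.1 c _ hc, g.1 c' _ hc'] at this
      simpa using this l p
    · rintro ⟨c, hc⟩ ⟨c', hc'⟩ e l p
      have := q4 ⟨c, sdiag_left h2 hc⟩ ⟨c', sdiag_left h2 hc'⟩ e
      rw [Fin.ext_iff] at *
      rw [g.1 c _ hc, g.1 c' _ hc'] at this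
      simpa using this l p
    · rintro ⟨c, hc⟩ e l p
      have := q5 ⟨c, sdiag_left h2 hc⟩ e l
      rw [g.1 c _ hc] at this
      exact this p
    · rintro ⟨c, hc⟩ ⟨c', hc'⟩ e l
      have := q1 ⟨c, sdiag_right h1 hc⟩ ⟨c', sdiag_right h1 hc'⟩ e l
      rw [Fin.le_def] at *
      rw [g.2 c _ hc, g.2 c' _ hc'] at this
      omega
    · rintro ⟨c, hc⟩ ⟨c', hc'⟩ e l
      have := q2 ⟨c, sdiag_right h1 hc⟩ ⟨c', sdiag_right h1 hc'⟩ e l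
      rw [Fin.le_def] at *
      rw [g.2 c _ hc, g.2 c' _ hc'] at this
      omega
    · rintro ⟨c, hc⟩ ⟨c', hc'⟩ e l p
      have := q3 ⟨c, sdiag_right h1 hc⟩ ⟨c', sdiag_right h1 hc'⟩ e
      rw [Fin.ext_iff] at *
      rw [g.2 c _ hc, g.2 c' _ hc', ev] at this
      simpa using this (by omega) p
    · rintro ⟨c, hc⟩ ⟨c', hc'⟩ e l p
      have := q4 ⟨c, sdiag_right h1 hc⟩ ⟨c', sdiag_right h1 hc'⟩ e
      rw [Fin.ext_iff] at *
      rw [g.2 c _ hc, g.2 c' _ hc', ev] at this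
      simpa using this (by omega) p
  · rintro ⟨⟨q1, q2, q3, q4, q5⟩, r1, r2, r3, r4⟩
    refine ⟨?_, ?_, ?_, ?_, ?_⟩
    · rintro ⟨c, hc⟩ ⟨c', hc'⟩ e l
      rw [Fin.le_def]
      rcases sdiag_or (ν := ν) hc with d | d <;> rcases sdiag_or (ν := ν) hc' with d' | d'
      · rw [g.1 c _ d, g.1 c' _ d']
        exact q1 ⟨c, d⟩ ⟨c', d'⟩ e l
      · rw [g.1 c _ d, g.2 c' _ d']
        have := (TC ⟨c, d⟩).2
        omega
      · exfalso
        obtain ⟨i, j⟩ := c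
        obtain ⟨i', j'⟩ := c'
        simp only [mem_sdiag] at *
        subst e
        omega
      · rw [g.2 c _ d, g.2 c' _ d']
        have := r1 ⟨c, d⟩ ⟨c', d'⟩ e l
        rw [Fin.le_def] at this
        omega
    · rintro ⟨c, hc⟩ ⟨c', hc'⟩ e l
      rw [Fin.le_def]
      rcases sdiag_or (ν := ν) hc with d | d <;> rcases sdiag_or (ν := ν) hc' with d' | d'
      · rw [g.1 c _ d, g.1 c' _ d']
        exact q2 ⟨c, d⟩ ⟨c', d'⟩ e l
      · rw [g.1 c _ d, g.2 c' _ d']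
        have := (TC ⟨c, d⟩).2
        omega
      · exfalso
        obtain ⟨i, j⟩ := c
        obtain ⟨i', j'⟩ := c'
        simp only [mem_sdiag] at *
        subst e
        have := ν.col_down l (j := j) (by omega) (by omega)
        omega
      · rw [g.2 c _ d, g.2 c' _ d']
        have := r2 ⟨c, d⟩ ⟨c', d'⟩ e l
        rw [Fin.le_def] at this
        omega
    · rintro ⟨c, hc⟩ ⟨c', hc'⟩ e l p
      rw [Fin.ext_iff] at l
      rcases sdiag_or (ν := ν) hc with d | d <;> rcases sdiag_or (ν := ν) hc' with d' | d'
      · rw [g.1 c _ d] at l p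
        rw [g.1 c' _ d'] at l
        simpa using q3 ⟨c, d⟩ ⟨c', d'⟩ e (Fin.ext l) p
      · rw [g.1 c _ d, g.2 c' _ d'] at l
        have := (TC ⟨c, d⟩).2
        omega
      · rw [g.2 c _ d, g.1 c' _ d'] at l
        have := (TC ⟨c', d'⟩).2
        omega
      · rw [g.2 c _ d] at l p
        rw [g.2 c' _ d'] at l
        simpa using r3 ⟨c, d⟩ ⟨c', d'⟩ e (Fin.ext (by omega)) ((ev _).1 p)
    · rintro ⟨c, hc⟩ ⟨c', hc'⟩ e l p
      rw [Fin.ext_iff] at l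
      rcases sdiag_or (ν := ν) hc with d | d <;> rcases sdiag_or (ν := ν) hc' with d' | d'
      · rw [g.1 c _ d] at l p
        rw [g.1 c' _ d'] at l
        simpa using q4 ⟨c, d⟩ ⟨c', d'⟩ e (Fin.ext l) p
      · rw [g.1 c _ d, g.2 c' _ d'] at l
        have := (TC ⟨c, d⟩).2
        omega
      · rw [g.2 c _ d, g.1 c' _ d'] at l
        have := (TC ⟨c', d'⟩).2
        omega
      · rw [g.2 c _ d] at l p
        rw [g.2 c' _ d'] at l
        simpa using r4 ⟨c, d⟩ ⟨c', d'⟩ e (Fin.ext (by omega)) (fun hh => p ((ev _).2 hh))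
    · rintro ⟨c, hc⟩ e l p
      have d := (g.lt_iff hc).1 p
      rw [g.1 c _ d] at p ⊢
      exact q5 ⟨c, d⟩ e l p

open scoped Classical in
theorem cnt_eq {D : Finset (ℕ × ℕ)} {A : ℕ} (T : {c // c ∈ D} → Fin A) (v : ℕ) :
    cnt T v = (D.filter fun c => ∃ h : c ∈ D, (T ⟨c, h⟩ : ℕ) = v).card := by
  rw [cnt, ← Finset.card_map (Function.Embedding.subtype _)]
  congr 1
  ext c
  simp only [Finset.mem_map, Finset.mem_filter, Finset.mem_univ, true_and,
    Function.Embedding.coe_subtype, Subtype.exists, exists_and_right, exists_eq_right]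
  constructor
  · rintro ⟨h, e⟩; exact ⟨h, h, e⟩
  · rintro ⟨h, h', e⟩; exact ⟨h, e⟩

theorem Glued.cntC (h2 : ν.Sub lam)
    {T : {c // c ∈ sdiag lam mu} → Fin (2 * (n + k))}
    {TC : {c // c ∈ sdiag ν mu} → Fin (2 * (k + k))}
    {TA : {c // c ∈ sdiag lam ν} → Fin (2 * (n - k))} (g : Glued T TC TA)
    {v : ℕ} (hv : v < 4 * k) : cnt T v = cnt TC v := by
  classical
  rw [cnt_eq, cnt_eq]
  congr 1
  ext c
  simp only [Finset.mem_filter]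
  constructor
  · rintro ⟨h, h', e⟩
    have d := (g.lt_iff h).1 (by omega)
    exact ⟨d, d, by rw [← g.1 c h d, e]⟩
  · rintro ⟨h, h', e⟩
    have d : c ∈ sdiag lam mu := sdiag_left h2 h
    exact ⟨d, d, by rw [g.1 c d h, e]⟩

theorem Glued.cntA (h1 : mu.Sub ν)
    {T : {c // c ∈ sdiag lam mu} → Fin (2 * (n + k))}
    {TC : {c // c ∈ sdiag ν mu} → Fin (2 * (k + k))}
    {TA : {c // c ∈ sdiag lam ν} → Fin (2 * (n - k))} (g : Glued T TC TA)
    (v : ℕ) : cnt T (4 * k + v) = cnt TA v := by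
  classical
  rw [cnt_eq, cnt_eq]
  congr 1
  ext c
  simp only [Finset.mem_filter]
  constructor
  · rintro ⟨h, h', e⟩
    rcases sdiag_or (ν := ν) h with d | d
    · have := (g.lt_iff h).2 d
      omega
    · have := g.2 c h d
      exact ⟨d, d, by omega⟩
  · rintro ⟨h, h', e⟩
    have d : c ∈ sdiag lam mu := sdiag_right h1 h
    exact ⟨d, d, by rw [g.2 c d h, e]⟩

theorem Glued.weight (h1 : mu.Sub ν) (h2 : ν.Sub lam)
    {T : {c // c ∈ sdiag lam mu} → Fin (2 * (n + k))}
    {TC : {c // c ∈ sdiag ν mu} → Fin (2 * (k + k))}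
    {TA : {c // c ∈ sdiag lam ν} → Fin (2 * (n - k))} (g : Glued T TC TA) :
    qtWeight k n T = MvPolynomial.C (qtWeightC k TC) * qtWeightA k n TA := by
  unfold qtWeight qtWeightC qtWeightA
  rw [map_prod]
  refine congrArg₂ (· * ·) ?_ ?_
  · refine Finset.prod_congr rfl fun i _ => ?_
    have := i.2
    rw [g.cntC h2 (by omega), g.cntC h2 (by omega), g.cntC h2 (by omega), g.cntC h2 (by omega)]
  · refine Finset.prod_congr rfl fun j _ => ?_
    rw [add_assoc (4 * k), g.cntA h1, g.cntA h1]

/-- The glued filling. -/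
def glue (hkn : k ≤ n) (TC : {c // c ∈ sdiag ν mu} → Fin (2 * (k + k)))
    (TA : {c // c ∈ sdiag lam ν} → Fin (2 * (n - k))) :
    {c // c ∈ sdiag lam mu} → Fin (2 * (n + k)) := fun c =>
  if h : c.1 ∈ sdiag ν mu then ⟨TC ⟨c.1, h⟩, by have := (TC ⟨c.1, h⟩).2; omega⟩
  else
    have h' : c.1 ∈ sdiag lam ν := (sdiag_or c.2).resolve_left h
    ⟨4 * k + TA ⟨c.1, h'⟩, by have := (TA ⟨c.1, h'⟩).2; omega⟩

theorem glue_glued (hkn : k ≤ n) (TC : {c // c ∈ sdiag ν mu} → Fin (2 * (k + k)))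
    (TA : {c // c ∈ sdiag lam ν} → Fin (2 * (n - k))) :
    Glued (glue hkn TC TA) TC TA := by
  constructor
  · intro c h h'
    simp [glue, h']
  · intro c h h'
    have : c ∉ sdiag ν mu := by
      obtain ⟨i, j⟩ := c
      simp only [mem_sdiag] at *
      omega
    simp [glue, this]

theorem Glued.unique {T T' : {c // c ∈ sdiag lam mu} → Fin (2 * (n + k))}
    {TC : {c // c ∈ sdiag ν mu} → Fin (2 * (k + k))}
    {TA : {c // c ∈ sdiag lam ν} → Fin (2 * (n - k))} (g : Glued T TC TA)
    (g' : Glued T' TC TA) : T = T' := by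
  ext ⟨c, h⟩
  rcases sdiag_or (ν := ν) h with d | d
  · rw [g.1 c h d, g'.1 c h d]
  · rw [g.2 c h d, g'.2 c h d]

theorem Glued.nu_unique {ν' : SPartn} (h1 : mu.Sub ν) (h2 : ν.Sub lam)
    (h1' : mu.Sub ν') (h2' : ν'.Sub lam)
    {T : {c // c ∈ sdiag lam mu} → Fin (2 * (n + k))}
    {TC : {c // c ∈ sdiag ν mu} → Fin (2 * (k + k))}
    {TA : {c // c ∈ sdiag lam ν} → Fin (2 * (n - k))} (g : Glued T TC TA)
    {TC' : {c // c ∈ sdiag ν' mu} → Fin (2 * (k + k))}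
    {TA' : {c // c ∈ sdiag lam ν'} → Fin (2 * (n - k))} (g' : Glued T TC' TA') : ν = ν' := by
  have key : ∀ c, c ∈ sdiag ν mu ↔ c ∈ sdiag ν' mu := by
    intro c
    constructor
    · intro h
      exact (g'.lt_iff (sdiag_left h2 h)).1 ((g.lt_iff (sdiag_left h2 h)).2 h)
    · intro h
      exact (g.lt_iff (sdiag_left h2' h)).1 ((g'.lt_iff (sdiag_left h2' h)).2 h)
  apply SPartn.ext_part
  intro i
  have a := h1 i
  have b := h1' i
  rcases lt_trichotomy (ν.part i) (ν'.part i) with h | h | h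
  · have := (key (i, ν.part i + i))
    simp only [mem_sdiag] at this
    omega
  · exact h
  · have := (key (i, ν'.part i + i))
    simp only [mem_sdiag] at this
    omega

theorem Glued.fill_unique (h1 : mu.Sub ν) (h2 : ν.Sub lam)
    {T : {c // c ∈ sdiag lam mu} → Fin (2 * (n + k))}
    {TC TC' : {c // c ∈ sdiag ν mu} → Fin (2 * (k + k))}
    {TA TA' : {c // c ∈ sdiag lam ν} → Fin (2 * (n - k))} (g : Glued T TC TA)
    (g' : Glued T TC' TA') : TC = TC' ∧ TA = TA' := by
  constructor
  · ext ⟨c, h⟩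
    rw [← g.1 c (sdiag_left h2 h) h, g'.1 c (sdiag_left h2 h) h]
  · ext ⟨c, h⟩
    have a := g.2 c (sdiag_right h1 h) h
    have b := g'.2 c (sdiag_right h1 h) h
    omega

theorem exists_glued (hsub : mu.Sub lam)
    (T : {c // c ∈ sdiag lam mu} → Fin (2 * (n + k))) (hT : IsQT k T) :
    ∃ ν : SPartn, mu.Sub ν ∧ ν.Sub lam ∧
      ∃ (TC : {c // c ∈ sdiag ν mu} → Fin (2 * (k + k)))
        (TA : {c // c ∈ sdiag lam ν} → Fin (2 * (n - k))), Glued T TC TA := by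
  classical
  obtain ⟨q1, q2, -⟩ := hT
  let P : ℕ → ℕ → Prop := fun i j => j < lam.part i + i ∧
    ∀ h : (i, j) ∈ sdiag lam mu, (T ⟨(i, j), h⟩ : ℕ) < 4 * k
  have Pdown : ∀ i j j', j ≤ j' → P i j' → P i j := by
    rintro i j j' l ⟨a, b⟩
    refine ⟨by omega, fun h => ?_⟩
    have h' : (i, j') ∈ sdiag lam mu := by rw [mem_sdiag] at *; omega
    have := q1 ⟨(i, j), h⟩ ⟨(i, j'), h'⟩ rfl l
    rw [Fin.le_def] at this
    have := b h'
    omega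
  have hf : ∀ i, ∃ m, ∀ j, P i j ↔ j < m := by
    intro i
    have ex : ∃ j, ¬ P i j := ⟨lam.part i + i, fun h => lt_irrefl _ h.1⟩
    refine ⟨Nat.find ex, fun j => ⟨fun h => ?_, fun h => ?_⟩⟩
    · by_contra hc
      exact Nat.find_spec ex (Pdown i _ j (not_lt.mp hc) h)
    · exact not_not.mp (Nat.find_min ex h)
  choose f hf using hf
  have flam : ∀ i, f i ≤ lam.part i + i := by
    intro i
    by_contra hc
    exact lt_irrefl _ ((hf i (lam.part i + i)).2 (by omega)).1
  have fmu : ∀ i, mu.part i + i ≤ f i := by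
    intro i
    by_contra hc
    have : P i (f i) := by
      have := hsub i
      refine ⟨by omega, fun h => ?_⟩
      rw [mem_sdiag] at h
      omega
    exact lt_irrefl _ ((hf i _).1 this)
  have fst : ∀ i, f (i + 1) - (i + 1) ≠ 0 → f (i + 1) - (i + 1) < f i - i := by
    intro i hi
    obtain ⟨a, b⟩ := (hf (i + 1) (f (i + 1) - 1)).2 (by omega)
    have : P i (f (i + 1) - 1) := by
      refine ⟨lam.col_down (Nat.le_succ i) (by omega) a, fun h => ?_⟩
      have h' : (i + 1, f (i + 1) - 1) ∈ sdiag lam mu := by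
        rw [mem_sdiag] at *
        refine ⟨?_, a⟩
        by_contra hc
        have := mu.col_down (Nat.le_succ i) (j := f (i + 1) - 1) (by omega) (by simpa using hc)
        omega
      have := q2 ⟨_, h⟩ ⟨_, h'⟩ rfl (Nat.le_succ i)
      rw [Fin.le_def] at this
      have := b h'
      omega
    have := (hf i _).1 this
    omega
  let ν : SPartn := ⟨fun i => f i - i, fst, ⟨lam.len, by
    have := flam lam.len
    have e : lam.part lam.len = 0 := Nat.find_spec lam.exists_zero
    omega⟩⟩
  have h1 : mu.Sub ν := fun i => by
    have := fmu i
    change mu.part i ≤ f i - i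
    omega
  have h2 : ν.Sub lam := fun i => by
    have := flam i
    change f i - i ≤ lam.part i
    omega
  have lt : ∀ c (h : c ∈ sdiag lam mu), c ∈ sdiag ν mu → (T ⟨c, h⟩ : ℕ) < 4 * k := by
    rintro ⟨i, j⟩ h h'
    rw [mem_sdiag] at h'
    have : j < f i - i + i := h'.2
    have := fmu i
    exact ((hf i j).2 (by omega)).2 h
  have ge : ∀ c (h : c ∈ sdiag lam mu), c ∈ sdiag lam ν → 4 * k ≤ (T ⟨c, h⟩ : ℕ) := by
    rintro ⟨i, j⟩ h h'
    rw [mem_sdiag] at h'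
    have : f i - i + i ≤ j := h'.1
    by_contra hc
    have := (hf i j).1 ⟨h'.2, fun _ => by omega⟩
    omega
  refine ⟨ν, h1, h2, fun c => ⟨T ⟨c.1, sdiag_left h2 c.2⟩, ?_⟩,
    fun c => ⟨T ⟨c.1, sdiag_right h1 c.2⟩ - 4 * k, ?_⟩, ?_, ?_⟩
  · have := lt c.1 (sdiag_left h2 c.2) c.2
    omega
  · have := ge c.1 (sdiag_right h1 c.2) c.2
    have := (T ⟨c.1, sdiag_right h1 c.2⟩).2
    omega
  · intro c h h'
    rfl
  · intro c h h'
    have := ge c h h'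
    simp only
    omega

theorem finite_between (lam mu : SPartn) : Finite {ν : SPartn // mu.Sub ν ∧ ν.Sub lam} := by
  let F : {ν : SPartn // mu.Sub ν ∧ ν.Sub lam} → (Fin lam.len → Fin (lam.part 0 + 1)) :=
    fun ν i => ⟨ν.1.part i, by
      have := ν.2.2 i
      have := lam.part_anti (Nat.zero_le i)
      omega⟩
  apply Finite.of_injective F
  intro a b h
  apply Subtype.ext
  apply SPartn.ext_part
  intro i
  by_cases hi : i < lam.len
  · have := congrFun h ⟨i, hi⟩
    simpa [F] using this
  · have h0 : lam.part i = 0 := by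
      by_contra hc
      exact hi (lam.lt_len (by omega))
    have := a.2.2 i
    have := b.2.2 i
    omega

end

/-- The tableau-sum of intermediate symplectic primed shifted tableaux of shape
`S(λ/μ)` factors over the strict partitions `μ ⊆ ν ⊆ λ` occupied by the letters
`1′, 1, 1̄′, 1̄, …, k′, k, k̄′, k̄`:
`Σ_{T ∈ QT^{(k,n−k)}(λ/μ)} x^T
  = Σ_ν (Σ_{T_C ∈ QT^{(k,0)}(ν/μ)} x^{T_C}) (Σ_{T_A} x^{T_A})`. -/
theorem qT_sum_factorization (k n : ℕ) (hkn : k ≤ n) (lam mu : SPartn)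
    (hsub : mu.Sub lam) (hlen : lam.len ≤ n) :
    (∑ᶠ (T : {c // c ∈ sdiag lam mu} → Fin (2 * (n + k))) (_ : IsQT k T),
        qtWeight k n T) =
      ∑ᶠ (ν : SPartn) (_ : mu.Sub ν ∧ ν.Sub lam),
        MvPolynomial.C
          (∑ᶠ (TC : {c // c ∈ sdiag ν mu} → Fin (2 * (k + k))) (_ : IsQT k TC),
            qtWeightC k TC) *
        ∑ᶠ (TA : {c // c ∈ sdiag lam ν} → Fin (2 * (n - k))) (_ : IsQTA TA),
          qtWeightA k n TA := by
  classical
  haveI := finite_between lam mu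
  haveI := Fintype.ofFinite {ν : SPartn // mu.Sub ν ∧ ν.Sub lam}
  rw [← finsum_subtype_eq_finsum_cond (f := fun T => qtWeight k n T) (fun T => IsQT k T),
    finsum_eq_sum_of_fintype,
    ← finsum_subtype_eq_finsum_cond (f := fun ν : SPartn => MvPolynomial.C
          (∑ᶠ (TC : {c // c ∈ sdiag ν mu} → Fin (2 * (k + k))) (_ : IsQT k TC),
            qtWeightC k TC) *
        ∑ᶠ (TA : {c // c ∈ sdiag lam ν} → Fin (2 * (n - k))) (_ : IsQTA TA),
          qtWeightA k n TA) (fun ν => mu.Sub ν ∧ ν.Sub lam), finsum_eq_sum_of_fintype]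
  let B : {ν : SPartn // mu.Sub ν ∧ ν.Sub lam} → Type := fun ν =>
    {TC : {c // c ∈ sdiag ν.1 mu} → Fin (2 * (k + k)) // IsQT k TC} ×
      {TA : {c // c ∈ sdiag lam ν.1} → Fin (2 * (n - k)) // IsQTA TA}
  have step : ∀ ν : {ν : SPartn // mu.Sub ν ∧ ν.Sub lam},
      (MvPolynomial.C
          (∑ᶠ (TC : {c // c ∈ sdiag ν.1 mu} → Fin (2 * (k + k))) (_ : IsQT k TC),
            qtWeightC k TC) *
        ∑ᶠ (TA : {c // c ∈ sdiag lam ν.1} → Fin (2 * (n - k))) (_ : IsQTA TA),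
          qtWeightA k n TA : IRing k (n - k)) =
      ∑ p : B ν, MvPolynomial.C (qtWeightC k p.1.1) * qtWeightA k n p.2.1 := by
    intro ν
    rw [← finsum_subtype_eq_finsum_cond (f := fun T => qtWeightC k T) (fun T => IsQT k T),
      finsum_eq_sum_of_fintype,
      ← finsum_subtype_eq_finsum_cond (f := fun T => qtWeightA k n T) (fun T => IsQTA T),
      finsum_eq_sum_of_fintype, map_sum, Finset.sum_mul_sum, Fintype.sum_prod_type]
  rw [Finset.sum_congr rfl fun ν _ => step ν, ← Finset.univ.sum_sigma (fun _ => Finset.univ)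
    (fun p : Sigma B => (MvPolynomial.C (qtWeightC k p.2.1.1) * qtWeightA k n p.2.2.1 :
      IRing k (n - k))), Finset.univ_sigma_univ]
  symm
  refine Fintype.sum_bijective (fun p : Sigma B =>
    (⟨glue hkn p.2.1.1 p.2.2.1, ((glue_glued hkn p.2.1.1 p.2.2.1).isQT p.1.2.1 p.1.2.2).2
      ⟨p.2.1.2, p.2.2.2⟩⟩ :
      {T : {c // c ∈ sdiag lam mu} → Fin (2 * (n + k)) // IsQT k T})) ⟨?_, ?_⟩ _ _ ?_
  · rintro ⟨⟨ν, hν⟩, ⟨TC, hC⟩, ⟨TA, hA⟩⟩ ⟨⟨ν', hν'⟩, ⟨TC', hC'⟩, ⟨TA', hA'⟩⟩ h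
    have h := congrArg Subtype.val h
    simp only at h
    have g := glue_glued (lam := lam) (mu := mu) hkn TC TA
    have g' := glue_glued (lam := lam) (mu := mu) hkn TC' TA'
    rw [← h] at g'
    obtain rfl := g.nu_unique hν.1 hν.2 hν'.1 hν'.2 g'
    obtain ⟨rfl, rfl⟩ := g.fill_unique hν.1 hν.2 g'
    rfl
  · rintro ⟨T, hT⟩
    obtain ⟨ν, h1, h2, TC, TA, g⟩ := exists_glued hsub T hT
    have hh := (g.isQT h1 h2).1 hT
    exact ⟨⟨⟨ν, h1, h2⟩, ⟨TC, hh.1⟩, ⟨TA, hh.2⟩⟩, Subtype.ext ((glue_glued hkn TC TA).unique g)⟩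
  · rintro ⟨⟨ν, hν⟩, ⟨TC, hC⟩, ⟨TA, hA⟩⟩
    exact ((glue_glued hkn TC TA).weight hν.1 hν.2).symm

end
end

section
/- (Jozefiak–Pragacz-type Pfaffian formula.) Let k ≤ n be nonnegative integers, λ = (λ₁>⋯>λ_l>0) a strict partition with l ≥ 2 and l ≤ n, and μ = (μ₁>⋯>μ_m≥0) a strict partition with μ ⊆ λ and l+m even. Then in ℚ[x₁^{±1},…,x_k^{±1}][x_{k+1},…,xₙ]: Q^{(k,n−k)}_{λ/μ}(x₁,…,xₙ) = Pf [[M^I_λ, N^I_{λ,μ}],[−(N^I_{λ,μ})ᵀ, O]], where M^I_λ is the l×l skew-symmetric matrix whose (i,j)-entry for i < j is the intermediate symplectic Q-polynomial Q^{(k,n−k)}_{(λ_i,λ_j)}(x₁,…,xₙ) of the two-row strict partition (λ_i,λ_j) (with zero diagonal and (j,i)-entry the negative of the (i,j)-entry), and N^I_{λ,μ} is the l×m matrix with (i,j)-entry the one-row polynomial Q^{(k,n−k)}_{(λ_i−μ_{m+1−j})}(x₁,…,xₙ), under the conventions Q^{(k,n−k)}_{(0)} := 1 and Q^{(k,n−k)}_{(r)}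 := 0 for r < 0. -/
open MvPolynomial

noncomputable section

noncomputable section


/-- `q_r ∈ Λ`, determined by `q_0 = 1` and the recursion
`r·q_r = 2·Σ_{1 ≤ i ≤ r, i odd} p_i·q_{r−i}` (here `X i` is `p_{i+1}`). -/
def qSym : ℕ → SymF
  | 0 => 1
  | (r + 1) =>
      (((r : ℚ) + 1))⁻¹ • (2 * ∑ i ∈ Finset.range (r + 1),
        if Odd (i + 1) then X i * qSym (r - i) else 0)
  decreasing_by exact Nat.lt_succ_of_le (Nat.sub_le r i)

/-- `q_r` for `r ∈ ℤ`, with `q_r = 0` for `r < 0`. -/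
def qZ (z : ℤ) : SymF := if 0 ≤ z then qSym z.toNat else 0

/-- `h_r ∈ Λ`, determined by `h_0 = 1` and the Newton recursion
`r·h_r = Σ_{i=1}^r p_i·h_{r−i}` (here `X i` is `p_{i+1}`). -/
def hSym : ℕ → SymF
  | 0 => 1
  | (r + 1) =>
      (((r : ℚ) + 1))⁻¹ • (∑ i ∈ Finset.range (r + 1), X i * hSym (r - i))
  decreasing_by exact Nat.lt_succ_of_le (Nat.sub_le r i)

/-- `h_r` for `r ∈ ℤ`, with `h_r = 0` for `r < 0`. -/
def hZ (z : ℤ) : SymF := if 0 ≤ z then hSym z.toNat else 0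

/-- `Q^A_{(r,s)}` for `r > s`. -/
def QA2core (r s : ℕ) : SymF :=
  qSym r * qSym s +
    2 * ∑ t ∈ Finset.Icc 1 s, (-1 : SymF) ^ t * (qZ ((r : ℤ) + t) * qZ ((s : ℤ) - t))

/-- Schur's `Q`-function of a two-row diagram, `Q^A_{(r,s)}`, with the conventions
`Q^A_{(r,0)} = q_r`, `Q^A_{(r,r)} = 0`, `Q^A_{(s,r)} = −Q^A_{(r,s)}`. -/
def QA2 (r s : ℕ) : SymF :=
  if s < r then QA2core r s else if r < s then -QA2core s r else 0

/-- `Q^C_{(r,s)}` for `r > s`. -/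
def QC2core (r s : ℕ) : SymF :=
  qSym r * qSym s +
    2 * ∑ t ∈ Finset.Icc 1 s, (-1 : SymF) ^ t *
      ((qZ ((r : ℤ) + t) + 2 * (∑ i ∈ Finset.Icc 1 (t - 1), qZ ((r : ℤ) + t - 2 * i))
          + qZ ((r : ℤ) - t)) * qZ ((s : ℤ) - t))

/-- The symplectic `Q`-function of a two-row diagram, `Q^C_{(r,s)}`, with the same
conventions as in the type `A` case. -/
def QC2 (r s : ℕ) : SymF :=
  if s < r then QC2core r s else if r < s then -QC2core s r else 0

/-- The Pfaffian `Pf(B) = (2^m m!)⁻¹ Σ_σ sgn(σ) Π_t B_{σ(2t−1),σ(2t)}`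
of an `N × N` matrix (intended for skew-symmetric `B` with `N` even, `N = 2m`). -/
def Pf {R : Type*} [CommRing R] [Algebra ℚ R] {N : ℕ}
    (B : Matrix (Fin N) (Fin N) R) : R :=
  (((2 : ℚ) ^ (N / 2) * (N / 2).factorial))⁻¹ •
    ∑ σ : Equiv.Perm (Fin N),
      ((Equiv.Perm.sign σ : ℤˣ) : ℤ) •
        ∏ t ∈ (Finset.range (N / 2)).attach,
          B (σ ⟨2 * t.1, by have := Finset.mem_range.mp t.2; omega⟩)
            (σ ⟨2 * t.1 + 1, by have := Finset.mem_range.mp t.2; omega⟩)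

/-- The skew `Q`-function `Q^X_{λ/μ}` (for `X = A, C` according to the two-row
function `Q2`), defined as the Pfaffian of the block matrix
`[[M^X_λ, N_{λ,μ}], [−N_{λ,μ}ᵀ, O]]`, where `μ` is padded with a zero part
whenever `ℓ(λ) + ℓ(μ)` is odd. -/
def skewQ (Q2 : ℕ → ℕ → SymF) (lam mu : SPartn) : SymF :=
  let l := lam.len
  let m := if Even (l + mu.len) then mu.len else mu.len + 1
  Pf (N := l + m) (Matrix.of fun i j =>
    if _hi : (i : ℕ) < l then
      if _hj : (j : ℕ) < l then Q2 (lam.part i) (lam.part j)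
      else qZ ((lam.part i : ℤ) - mu.part (m - 1 - ((j : ℕ) - l)))
    else
      if _hj : (j : ℕ) < l then - qZ ((lam.part j : ℤ) - mu.part (m - 1 - ((i : ℕ) - l)))
      else 0)

/-- The skew Schur `Q`-function `Q^A_{λ/μ}`. -/
def QAskew (lam mu : SPartn) : SymF := skewQ QA2 lam mu

/-- The skew symplectic `Q`-function `Q^C_{λ/μ}`. -/
def QCskew (lam mu : SPartn) : SymF := skewQ QC2 lam mu

/-- `π_A^{(n)} : Λ → ℚ[x₁,…,xₙ]`, `p_r ↦ x₁^r + ⋯ + xₙ^r`. -/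
def piA (n : ℕ) : SymF →ₐ[ℚ] MvPolynomial (Fin n) ℚ :=
  aeval fun r => ∑ i : Fin n, X i ^ (r + 1)

/-- `π_C^{(n)} : Λ → ℚ[x₁^{±1},…,xₙ^{±1}]`, `p_r ↦ Σ (x_i^r + x_i^{-r})`. -/
def piC (n : ℕ) : SymF →ₐ[ℚ] Laur n :=
  aeval fun r => ∑ i : Fin n, (lX i ((r : ℤ) + 1) + lX i (-((r : ℤ) + 1)))

/-- `π_A^{(n-k)}` with the variables renamed `x_{k+1}, …, x_n`, landing in
`ℚ[x₁^{±1},…,x_k^{±1}][x_{k+1},…,xₙ]`: `p_r ↦ x_{k+1}^r + ⋯ + x_n^r`. -/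
def piAupper (k n : ℕ) : SymF →ₐ[ℚ] IRing k (n - k) :=
  aeval fun r => ∑ j : Fin (n - k), (X j : IRing k (n - k)) ^ (r + 1)

open scoped Classical in
/-- The intermediate symplectic `Q`-polynomial
`Q^{(k,n−k)}_{λ/μ}(x₁,…,xₙ) = Σ_ν π_C^{(k)}(Q^C_{ν/μ}) · π_A^{(n−k)}(Q^A_{λ/ν})`,
the sum being over all strict partitions `ν` with `μ ⊆ ν ⊆ λ`. -/
def interQ (k n : ℕ) (lam mu : SPartn) : IRing k (n - k) :=
  ∑ᶠ (ν : SPartn) (_ : mu.Sub ν ∧ ν.Sub lam),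
    C (piC k (QCskew ν mu)) * piAupper k n (QAskew lam ν)

/-- The one-row intermediate symplectic `Q`-polynomial `Q^{(k,n−k)}_{(z)}` for `z ∈ ℤ`,
with the conventions `Q^{(k,n−k)}_{(0)} := 1` and `Q^{(k,n−k)}_{(z)} := 0` for `z < 0`. -/
def interQrowZ (k n : ℕ) (z : ℤ) : IRing k (n - k) :=
  if z < 0 then 0 else if z = 0 then 1
  else interQ k n (SPartn.single z.toNat) SPartn.empty

namespace JP

section General
variable {R M N : Type*} [CommRing R] [AddCommGroup M] [Module R M] [AddCommGroup N] [Module R N]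

/-- contraction on the exterior algebra -/
noncomputable def ctr (d : Module.Dual R M) : ExteriorAlgebra R M →ₗ[R] ExteriorAlgebra R M :=
  CliffordAlgebra.contractLeft (Q := (0 : QuadraticForm R M)) d

noncomputable def inv : ExteriorAlgebra R M →ₐ[R] ExteriorAlgebra R M :=
  CliffordAlgebra.involute (Q := (0 : QuadraticForm R M))

noncomputable def eps : ExteriorAlgebra R M →ₐ[R] R := ExteriorAlgebra.algebraMapInv

theorem ext_ind {P : ExteriorAlgebra R M → Prop} (x : ExteriorAlgebra R M)
    (h0 : ∀ r, P (algebraMap R _ r)) (ha : ∀ x y, P x → P y → P (x + y))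
    (hm : ∀ (v : M) x, P x → P (ExteriorAlgebra.ι R v * x)) : P x :=
  CliffordAlgebra.left_induction (0 : QuadraticForm R M) h0 ha (fun x v hx => hm v x hx) x

open ExteriorAlgebra (ι)

@[simp] theorem ctr_ι_mul (d : Module.Dual R M) (v : M) (x : ExteriorAlgebra R M) :
    ctr d (ι R v * x) = d v • x - ι R v * ctr d x :=
  CliffordAlgebra.contractLeft_ι_mul (Q := (0 : QuadraticForm R M)) d v x

@[simp] theorem ctr_algebraMap (d : Module.Dual R M) (r : R) :
    ctr d (algebraMap R (ExteriorAlgebra R M) r) = 0 :=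
  CliffordAlgebra.contractLeft_algebraMap (0 : QuadraticForm R M) d r

@[simp] theorem ctr_one (d : Module.Dual R M) :
    ctr d (1 : ExteriorAlgebra R M) = 0 :=
  CliffordAlgebra.contractLeft_one (0 : QuadraticForm R M) d

theorem ctr_add_dual (d d' : Module.Dual R M) (x) : ctr (d + d') x = ctr d x + ctr d' x := by
  simp [ctr]

theorem ctr_neg_dual (d : Module.Dual R M) (x) : ctr (-d) x = - ctr d x := by
  simp [ctr]

theorem ctr_zero_dual (x : ExteriorAlgebra R M) : ctr (0 : Module.Dual R M) x = 0 := by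
  simp [ctr]

@[simp] theorem inv_ι (v : M) : inv (ι R v) = - ι R v :=
  CliffordAlgebra.involute_ι (Q := (0 : QuadraticForm R M)) v

@[simp] theorem eps_ι (v : M) : eps (ι R v) = 0 := by
  simp [eps, ExteriorAlgebra.algebraMapInv]

theorem ι_mul_self (v : M) (x : ExteriorAlgebra R M) : ι R v * (ι R v * x) = 0 := by
  rw [← mul_assoc, ExteriorAlgebra.ι_sq_zero, zero_mul]

theorem ι_anti (v w : M) : ι R v * ι R w = - (ι R w * ι R v) := by
  have := ExteriorAlgebra.ι_add_mul_swap (R := R) v w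
  exact eq_neg_of_add_eq_zero_left this

theorem ι_mul_comm (v : M) (x : ExteriorAlgebra R M) : ι R v * x = inv x * ι R v := by
  induction x using ext_ind with
  | h0 r => simp [Algebra.commutes]
  | ha x y hx hy => simp [mul_add, add_mul, hx, hy]
  | hm w x hx =>
    rw [← mul_assoc, ι_anti, map_mul, inv_ι, neg_mul, mul_assoc, hx]
    simp [mul_assoc]

theorem inv_ctr (d : Module.Dual R M) (x : ExteriorAlgebra R M) :
    inv (ctr d x) = - ctr d (inv x) := by
  induction x using ext_ind with
  | h0 r => simp
  | ha x y hx hy => simp [hx, hy]; abel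
  | hm w x hx => simp [hx]

theorem eps_inv (x : ExteriorAlgebra R M) : eps (inv x) = eps x := by
  induction x using ext_ind with
  | h0 r => simp
  | ha x y hx hy => simp [hx, hy]
  | hm w x hx => simp

theorem eps_map (T : M →ₗ[R] N) (x : ExteriorAlgebra R M) :
    eps (ExteriorAlgebra.map T x) = eps x := by
  induction x using ext_ind with
  | h0 r => simp
  | ha x y hx hy => simp [hx, hy]
  | hm w x hx => simp

theorem ctr_map (T : M →ₗ[R] N) (d : Module.Dual R N) (x : ExteriorAlgebra R M) :
    ctr d (ExteriorAlgebra.map T x) = ExteriorAlgebra.map T (ctr (d ∘ₗ T) x) := by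
  induction x using ext_ind with
  | h0 r => simp
  | ha x y hx hy => simp [hx, hy]
  | hm w x hx => simp [hx]

theorem ctr_mul_of_zero (d : Module.Dual R M) (x y : ExteriorAlgebra R M) (hy : ctr d y = 0) :
    ctr d (x * y) = ctr d x * y := by
  induction x using ext_ind with
  | h0 r => simp [← Algebra.smul_def, hy]
  | ha x y hx hy => simp [hx, hy, add_mul]
  | hm w x hx => simp [hx, mul_assoc, sub_mul]

/-- the Gaussian operator attached to an alternating form -/
noncomputable def gauss (B : LinearMap.BilinForm R M) (hB : ∀ x, B x x = 0) :
    ExteriorAlgebra R M →ₗ[R] ExteriorAlgebra R M :=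
  CliffordAlgebra.changeForm (Q := (0 : QuadraticForm R M)) (Q' := (0 : QuadraticForm R M))
    (B := -B) (by ext x; simp [hB])

variable (B : LinearMap.BilinForm R M) (hB : ∀ x, B x x = 0)

@[simp] theorem gauss_ι_mul (v : M) (x : ExteriorAlgebra R M) :
    gauss B hB (ι R v * x) = ι R v * gauss B hB x + ctr (B v) (gauss B hB x) := by
  have := CliffordAlgebra.changeForm_ι_mul (Q := (0 : QuadraticForm R M))
    (Q' := (0 : QuadraticForm R M)) (B := -B) (by ext x; simp [hB]) v x
  refine this.trans ?_
  simp only [LinearMap.neg_apply, map_neg, sub_neg_eq_add]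
  rfl

@[simp] theorem gauss_algebraMap (r : R) :
    gauss B hB (algebraMap R _ r) = algebraMap R _ r :=
  CliffordAlgebra.changeForm_algebraMap (Q := (0 : QuadraticForm R M)) _ r

theorem gauss_ctr (d : Module.Dual R M) (x : ExteriorAlgebra R M) :
    gauss B hB (ctr d x) = ctr d (gauss B hB x) :=
  CliffordAlgebra.changeForm_contractLeft (Q := (0 : QuadraticForm R M)) _ d x

theorem gauss_gauss (B' : LinearMap.BilinForm R M) (hB' : ∀ x, B' x x = 0)
    (B'' : LinearMap.BilinForm R M) (hB'' : ∀ x, B'' x x = 0) (h : B'' = B + B')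
    (x : ExteriorAlgebra R M) :
    gauss B' hB' (gauss B hB x) = gauss B'' hB'' x := by
  subst h
  induction x using ext_ind with
  | h0 r => simp
  | ha x y hx hy => simp [hx, hy]
  | hm w x hx => simp [hx, gauss_ctr, ctr_add_dual]; abel

theorem gauss_inv (x : ExteriorAlgebra R M) :
    gauss B hB (inv x) = inv (gauss B hB x) := by
  induction x using ext_ind with
  | h0 r => simp
  | ha x y hx hy => simp [hx, hy]
  | hm w x hx => simp [hx, inv_ctr]; abel

theorem gauss_map (T : N →ₗ[R] M) (B' : LinearMap.BilinForm R N) (hB' : ∀ x, B' x x = 0)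
    (h : ∀ x y, B' x y = B (T x) (T y)) (x : ExteriorAlgebra R N) :
    gauss B hB (ExteriorAlgebra.map T x) = ExteriorAlgebra.map T (gauss B' hB' x) := by
  induction x using ext_ind with
  | h0 r => simp
  | ha x y hx hy => simp [hx, hy]
  | hm w x hx =>
    have : B' w = B (T w) ∘ₗ T := by ext y; simp [h]
    simp [hx, ctr_map, this]

theorem gauss_mul (x y : ExteriorAlgebra R M) (h1 : gauss B hB y = y)
    (h2 : ∀ v, ctr (B v) y = 0) : gauss B hB (x * y) = gauss B hB x * y := by
  induction x using ext_ind with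
  | h0 r => simp [← Algebra.smul_def, h1]
  | ha x y hx hy => simp [hx, hy, add_mul]
  | hm w x hx => simp [hx, mul_assoc, add_mul, ctr_mul_of_zero _ _ _ (h2 w)]

noncomputable def pfE : ExteriorAlgebra R M →ₗ[R] R := eps.toLinearMap ∘ₗ gauss B hB

theorem pfE_apply (x) : pfE B hB x = eps (gauss B hB x) := rfl

@[simp] theorem pfE_one : pfE B hB 1 = 1 := by
  have := gauss_algebraMap B hB 1
  rw [map_one] at this
  simp [pfE_apply, this]

theorem pfE_ι_mul (v : M) (x : ExteriorAlgebra R M) :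
    pfE B hB (ι R v * x) = pfE B hB (ctr (B v) x) := by
  simp [pfE_apply, gauss_ctr]

theorem pfE_inv (x : ExteriorAlgebra R M) : pfE B hB (inv x) = pfE B hB x := by
  simp [pfE_apply, gauss_inv, eps_inv]

theorem pfE_odd [Algebra ℚ R] (x : ExteriorAlgebra R M) (hx : inv x = -x) : pfE B hB x = 0 := by
  have h := pfE_inv B hB x
  rw [hx, map_neg] at h
  have h2 : (2 : ℚ) • pfE B hB x = 0 := by
    rw [two_smul]; nth_rewrite 1 [← h]; simp
  have := congrArg (fun y => (2⁻¹ : ℚ) • y) h2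
  simpa [smul_smul] using this

end General

section Idx
variable {R : Type*} [CommRing R] {I : Type*}

/-- bilinear form from its values on a basis -/
noncomputable def bil (F : I → I → R) : LinearMap.BilinForm R (I →₀ R) :=
  Finsupp.linearCombination R (fun i => Finsupp.linearCombination R (F i))

noncomputable def bs (i : I) : I →₀ R := Finsupp.single i 1

@[simp] theorem bil_bs (F : I → I → R) (i j : I) : bil F (bs i) (bs j) = F i j := by
  simp [bil, bs]

theorem bil_alt (F : I → I → R) (h0 : ∀ i, F i i = 0) (h1 : ∀ i j, F i j = - F j i)
    (x : I →₀ R) : bil F x x = 0 := by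
  have hs : ∀ x y, bil F x y = - bil F y x := by
    intro x y
    have : bil F = - (bil F).flip := by
      refine Finsupp.lhom_ext' fun i => LinearMap.ext_ring ?_
      refine Finsupp.lhom_ext' fun j => LinearMap.ext_ring ?_
      simpa [bs] using (bil_bs F i j).trans ((h1 i j).trans (congrArg _ (bil_bs F j i).symm))
    conv_lhs => rw [this]
    simp
  induction x using Finsupp.induction_linear with
  | zero => simp
  | add f g hf hg => simp [hf, hg, hs f g]
  | single i r =>
    have : (Finsupp.single i r : I →₀ R) = r • bs i := by simp [bs]
    rw [this]; simp [h0]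

end Idx
end JP

namespace JP

open ExteriorAlgebra (ι)

/-- sum over sublists -/
def subSum {R : Type*} [AddCommMonoid R] : List ℕ → (List ℕ → R) → R
  | [], F => F []
  | j :: J, F => subSum J F + subSum J (fun K => F (j :: K))

/-- `[L-1, ..., 0]` -/
def desc : ℕ → List ℕ
  | 0 => []
  | L + 1 => L :: desc L

theorem subSum_congr {R : Type*} [AddCommMonoid R] (J : List ℕ) (F G : List ℕ → R)
    (h : ∀ K, K.Sublist J → F K = G K) : subSum J F = subSum J G := by
  induction J generalizing F G with
  | nil => exact h [] (by simp)
  | cons j J ih =>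
    simp only [subSum]
    rw [ih F G fun K hK => h K (hK.cons j), ih _ _ fun K hK => h _ (hK.cons_cons j)]

theorem map_subSum {R S : Type*} [AddCommMonoid R] [AddCommMonoid S] (f : R →+ S)
    (J : List ℕ) (F : List ℕ → R) : f (subSum J F) = subSum J (fun K => f (F K)) := by
  induction J generalizing F with
  | nil => rfl
  | cons j J ih => simp [subSum, ih]

theorem subSum_add {R : Type*} [AddCommMonoid R] (J : List ℕ) (F G : List ℕ → R) :
    subSum J (fun K => F K + G K) = subSum J F + subSum J G := by
  induction J generalizing F G with
  | nil => rfl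
  | cons j J ih => simp only [subSum, ih]; abel

theorem subSum_zero {R : Type*} [AddCommMonoid R] (J : List ℕ) :
    subSum J (fun _ => (0 : R)) = 0 := by
  induction J with
  | nil => rfl
  | cons j J ih => simp [subSum, ih]

section
variable {R : Type*} [CommRing R]

abbrev W (R : Type*) [CommRing R] := (ℕ ⊕ ℕ) →₀ R

def blk (g h : ℕ → ℕ → R) : ℕ ⊕ ℕ → ℕ ⊕ ℕ → R
  | .inl a, .inl b => g a b
  | .inl a, .inr b => h a b
  | .inr b, .inl a => - h a b
  | .inr _, .inr _ => 0

/-- alternating scalar table -/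
structure Alt {I : Type*} (g : I → I → R) : Prop where
  diag : ∀ a, g a a = 0
  skew : ∀ a b, g a b = - g b a

theorem Alt.blk {g : ℕ → ℕ → R} (hg : Alt g) (h : ℕ → ℕ → R) : Alt (blk g h) where
  diag a := by cases a <;> simp [JP.blk, hg.diag]
  skew a b := by
    cases a <;> cases b <;> simp [JP.blk]
    exact hg.skew _ _

theorem Alt.bil {I : Type*} {g : I → I → R} (hg : Alt g) : ∀ x, bil g x x = 0 :=
  bil_alt g hg.diag hg.skew

noncomputable def prodL {I : Type*} (l : List I) : ExteriorAlgebra R (I →₀ R) :=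
  (l.map (fun i => ι R (bs i))).prod

@[simp] theorem prodL_nil {I : Type*} : (prodL ([] : List I) : ExteriorAlgebra R (I →₀ R)) = 1 := rfl
@[simp] theorem prodL_cons {I : Type*} (i : I) (l : List I) :
    (prodL (i :: l) : ExteriorAlgebra R (I →₀ R)) = ι R (bs i) * prodL l := rfl
@[simp] theorem prodL_append {I : Type*} (l l' : List I) :
    (prodL (l ++ l') : ExteriorAlgebra R (I →₀ R)) = prodL l * prodL l' := by
  simp [prodL]

noncomputable def pfL {I : Type*} (F : I → I → R) (hF : Alt F) (l : List I) : R :=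
  pfE (bil F) hF.bil (prodL l)

theorem inv_prodL {I : Type*} (l : List I) :
    inv (prodL l : ExteriorAlgebra R (I →₀ R)) = (-1 : R) ^ l.length • prodL l := by
  induction l with
  | nil => simp
  | cons i l ih => simp [ih, pow_succ]

/-- supported on `inl s` with `s < L` -/
def Sp (L : ℕ) (v : W R) : Prop := (∀ s, L ≤ s → v (.inl s) = 0) ∧ ∀ b, v (.inr b) = 0

inductive Gen (L : ℕ) : ExteriorAlgebra R (W R) → Prop
  | alg (r : R) : Gen L (algebraMap R _ r)
  | add {x y} : Gen L x → Gen L y → Gen L (x + y)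
  | mul {v x} : Sp L v → Gen L x → Gen L (ι R v * x)

theorem Gen.smul {L : ℕ} {x : ExteriorAlgebra R (W R)} (hx : Gen L x) (r : R) :
    Gen L (r • x) := by
  induction hx with
  | alg s => rw [Algebra.smul_def, ← map_mul]; exact .alg _
  | add _ _ h1 h2 => rw [smul_add]; exact .add h1 h2
  | mul hv _ h => rw [← mul_smul_comm]; exact .mul hv h

theorem Gen.ctr {L : ℕ} {x : ExteriorAlgebra R (W R)} (hx : Gen L x) (d) :
    Gen L (ctr d x) := by
  induction hx with
  | alg s => rw [ctr_algebraMap, ← map_zero (algebraMap R _)]; exact .alg _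
  | add _ _ h1 h2 => rw [map_add]; exact .add h1 h2
  | mul hv hx h =>
    rw [ctr_ι_mul, sub_eq_add_neg]
    refine .add (hx.smul _) ?_
    have := (Gen.mul hv h).smul (-1)
    simpa using this

theorem Gen.map {L L' : ℕ} {x : ExteriorAlgebra R (W R)} (hx : Gen L x) (T : W R →ₗ[R] W R)
    (hT : ∀ v, Sp L v → Sp L' (T v)) :
    Gen L' (ExteriorAlgebra.map T x) := by
  induction hx with
  | alg s => rw [AlgHom.commutes]; exact .alg _
  | add _ _ h1 h2 => rw [map_add]; exact .add h1 h2
  | mul hv hx h =>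
    rw [map_mul, ExteriorAlgebra.map_apply_ι]
    exact .mul (hT _ hv) h

theorem Gen.gauss {L : ℕ} {x : ExteriorAlgebra R (W R)} (hx : Gen L x) (B) (hB) :
    Gen L (gauss B hB x) := by
  induction hx with
  | alg s => rw [gauss_algebraMap]; exact .alg _
  | add _ _ h1 h2 => rw [map_add]; exact .add h1 h2
  | mul hv hx h => rw [gauss_ι_mul]; exact .add (.mul hv h) (h.ctr _)

/-- coordinate functional -/
noncomputable def co (k : ℕ) : Module.Dual R (W R) := Finsupp.lapply (.inl k)

theorem Gen.ctr_co {L : ℕ} {x : ExteriorAlgebra R (W R)} (hx : Gen L x) :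
    JP.ctr (co L) x = 0 := by
  induction hx with
  | alg s => simp
  | add _ _ h1 h2 => simp [h1, h2]
  | mul hv hx h => rw [ctr_ι_mul, h]; simp [co, hv.1 L le_rfl]

theorem Gen.split {L : ℕ} {x : ExteriorAlgebra R (W R)} (hx : Gen (L + 1) x) :
    ∃ y z, Gen L y ∧ Gen L z ∧ x = y + ι R (bs (.inl L)) * z := by
  induction hx with
  | alg r => exact ⟨algebraMap R _ r, algebraMap R _ 0, .alg _, .alg _, by simp⟩
  | add _ _ h1 h2 =>
    obtain ⟨y, z, hy, hz, rfl⟩ := h1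
    obtain ⟨y', z', hy', hz', rfl⟩ := h2
    exact ⟨y + y', z + z', .add hy hy', .add hz hz', by rw [mul_add]; abel⟩
  | @mul v _ hv hx h =>
    obtain ⟨y, z, hy, hz, rfl⟩ := h
    set c := v (.inl L) with hc
    set w := v - c • bs (.inl L) with hw
    have hwS : Sp L w := by
      constructor
      · intro s hs
        rcases hs.eq_or_lt with rfl | hs
        · simp [hw, bs, hc]
        · simp [hw, bs, hv.1 s hs, hs.ne]
      · intro b; simp [hw, bs, hv.2 b]
    have hvw : v = w + c • bs (.inl L) := by simp [hw]
    refine ⟨ι R w * y, c • y + (-1 : R) • (ι R w * z), .mul hwS hy,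
      .add (hy.smul _) ((Gen.mul hwS hz).smul _), ?_⟩
    have h1 : ι R w * (ι R (bs (.inl L)) * z) = - (ι R (bs (.inl L)) * (ι R w * z)) := by
      rw [← mul_assoc, ι_anti, neg_mul, mul_assoc]
    rw [hvw]
    simp only [map_add, map_smul, add_mul, mul_add, smul_mul_assoc, ι_mul_self, h1,
      smul_zero, add_zero, mul_smul_comm, neg_smul, one_smul, mul_neg]
    abel

noncomputable def ctrK (f : ℕ → Module.Dual R (W R)) :
    List ℕ → ExteriorAlgebra R (W R) →ₗ[R] ExteriorAlgebra R (W R)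
  | [] => LinearMap.id
  | k :: K => ctrK f K ∘ₗ ctr (f k)

theorem eps_ctrK_mul (L : ℕ) (K : List ℕ) (hK : ∀ k ∈ K, k < L) (z : ExteriorAlgebra R (W R)) :
    eps (ctrK co K (ι R (bs (.inl L)) * z)) = 0 := by
  induction K generalizing z with
  | nil => simp [ctrK]
  | cons k K ih =>
    have hk : L ≠ k := (hK k (by simp)).ne'
    simp only [ctrK, LinearMap.comp_apply, ctr_ι_mul]
    have : co k (bs (.inl L) : W R) = 0 := by simp [co, bs, hk]
    rw [this, zero_smul, zero_sub, map_neg, map_neg, ih (fun k hk => hK k (by simp [hk])), neg_zero]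

theorem mem_desc {L k : ℕ} : k ∈ desc L ↔ k < L := by
  induction L with
  | zero => simp [desc]
  | succ L ih => simp [desc, ih]; omega

theorem expand (L : ℕ) (x : ExteriorAlgebra R (W R)) (hx : Gen L x) :
    x = subSum (desc L) (fun K => eps (ctrK co K x) • prodL (K.map Sum.inl)) := by
  induction L generalizing x with
  | zero =>
    simp only [desc, subSum, ctrK, LinearMap.id_apply, List.map_nil, prodL_nil]
    induction hx with
    | alg r => simp [Algebra.algebraMap_eq_smul_one]
    | add _ _ h1 h2 => rw [map_add, add_smul, ← h1, ← h2]
    | @mul v x hv _ _ =>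
      have : v = 0 := by
        ext i; cases i
        · exact hv.1 _ (Nat.zero_le _)
        · exact hv.2 _
      simp [this]
  | succ L ih =>
    obtain ⟨y, z, hy, hz, rfl⟩ := hx.split
    simp only [desc, subSum]
    have e1 : subSum (desc L) (fun K => eps (ctrK co K (y + ι R (bs (.inl L)) * z)) •
        prodL (K.map Sum.inl)) = y := by
      conv_rhs => rw [ih y hy]
      refine subSum_congr _ _ _ fun K hK => ?_
      rw [map_add, map_add, eps_ctrK_mul L K (fun k hk => mem_desc.1 (hK.subset hk)), add_zero]
    have e2 : ctr (co L) (y + ι R (bs (.inl L)) * z) = z := by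
      rw [map_add, hy.ctr_co, ctr_ι_mul, hz.ctr_co]
      simp [co, bs]
    have e3 : subSum (desc L) (fun K => eps (ctrK co (L :: K) (y + ι R (bs (.inl L)) * z)) •
        prodL ((L :: K).map Sum.inl)) = ι R (bs (.inl L)) * z := by
      conv_rhs => rw [ih z hz]
      have := map_subSum (AddMonoidHom.mulLeft (ι R (bs (.inl L : ℕ ⊕ ℕ)))) (desc L)
        (fun K => eps (ctrK co K z) • prodL (R := R) (K.map Sum.inl))
      simp only [AddMonoidHom.coe_mulLeft] at this
      rw [this]
      refine subSum_congr _ _ _ fun K hK => ?_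
      simp only [ctrK, LinearMap.comp_apply, e2, List.map_cons, prodL_cons, mul_smul_comm]
    rw [e1, e3]

end
end JP

namespace JP

open ExteriorAlgebra (ι)

section
variable {R : Type*} [CommRing R]

noncomputable def TT (hA : ℕ → ℕ → R) : W R →ₗ[R] W R :=
  Finsupp.linearCombination R (Sum.elim
    (fun a => ∑ s ∈ Finset.range (a + 1), hA a s • bs (.inl s)) (fun b => bs (.inr b)))

@[simp] theorem TT_inl (hA : ℕ → ℕ → R) (a : ℕ) :
    TT hA (bs (.inl a)) = ∑ s ∈ Finset.range (a + 1), hA a s • bs (.inl s) := by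
  simp [TT, bs]

@[simp] theorem TT_inr (hA : ℕ → ℕ → R) (b : ℕ) :
    TT hA (bs (.inr b)) = bs (.inr b) := by
  simp [TT, bs]

noncomputable def pp : W R →ₗ[R] W R :=
  Finsupp.linearCombination R (Sum.elim (fun a => bs (.inl a)) (fun _ => 0))

@[simp] theorem pp_inl (a : ℕ) : (pp (bs (.inl a)) : W R) = bs (.inl a) := by simp [pp, bs]
@[simp] theorem pp_inr (a : ℕ) : (pp (bs (.inr a)) : W R) = 0 := by simp [pp, bs]

def gI (gA hA gC : ℕ → ℕ → R) (a b : ℕ) : R :=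
  gA a b + ∑ s ∈ Finset.range (a + 1), ∑ t ∈ Finset.range (b + 1), hA a s * gC s t * hA b t

def hI (hA hC : ℕ → ℕ → R) (a b : ℕ) : R :=
  ∑ s ∈ Finset.range (a + 1), hA a s * hC s b

theorem gI_alt {gA hA gC : ℕ → ℕ → R} (ha : Alt gA) (hc : Alt gC) : Alt (gI gA hA gC) := by
  have key : ∀ a b, gI gA hA gC a b = bil (blk gA 0) (bs (.inl a)) (bs (.inl b)) +
      bil (blk gC 0) (TT hA (bs (.inl a))) (TT hA (bs (.inl b))) := by
    intro a b
    simp only [TT_inl, map_sum, LinearMap.sum_apply, map_smul, LinearMap.smul_apply, bil_bs, blk,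
      gI, smul_eq_mul]
    congr 1
    rw [Finset.sum_comm]
    refine Finset.sum_congr rfl fun s _ => ?_
    rw [← Finset.sum_mul, mul_comm]
  have h1 := (ha.blk 0).bil
  have h2 := (hc.blk 0).bil
  have e : ∀ {B : LinearMap.BilinForm R (W R)}, (∀ x, B x x = 0) → ∀ x y, B x y = - B y x := by
    intro B hB x y
    have := hB (x + y)
    simp only [map_add, LinearMap.add_apply, hB, zero_add, add_zero] at this
    exact eq_neg_of_add_eq_zero_right this
  constructor
  · intro a; rw [key, h1, h2, add_zero]
  · intro a b; rw [key, key, e h1, e h2]; abel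

theorem dual_ext {d d' : Module.Dual R (W R)} (hl : ∀ a, d (bs (.inl a)) = d' (bs (.inl a)))
    (hr : ∀ a, d (bs (.inr a)) = d' (bs (.inr a))) : d = d' := by
  refine Finsupp.lhom_ext' fun i => LinearMap.ext_ring ?_
  cases i
  · exact hl _
  · exact hr _

theorem bil_ext {B B' : LinearMap.BilinForm R (W R)}
    (h : ∀ i j, B (bs i) (bs j) = B' (bs i) (bs j)) : B = B' := by
  refine Finsupp.lhom_ext' fun i => LinearMap.ext_ring ?_
  refine Finsupp.lhom_ext' fun j => LinearMap.ext_ring ?_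
  exact h i j

theorem bil_gI (gA hA gC hC : ℕ → ℕ → R) :
    bil (blk (gI gA hA gC) (hI hA hC)) =
      bil (blk gA 0) + (bil (blk gC hC)).compl₁₂ (TT hA) (TT hA) := by
  refine bil_ext ?_
  rintro (a | a) (b | b)
  · simp only [LinearMap.add_apply, LinearMap.compl₁₂_apply, TT_inl, map_sum, LinearMap.sum_apply,
      map_smul, LinearMap.smul_apply, bil_bs, blk, gI, smul_eq_mul]
    congr 1
    rw [Finset.sum_comm]
    refine Finset.sum_congr rfl fun s _ => ?_
    rw [← Finset.sum_mul, mul_comm]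
  · simp [blk, hI]
  · simp [blk, hI, Finset.sum_neg_distrib]
  · simp [blk]

theorem ctr_prodL_zero {I : Type*} (d : Module.Dual R (I →₀ R)) (l : List I)
    (h : ∀ i ∈ l, d (bs i) = 0) : ctr d (prodL l) = 0 := by
  induction l with
  | nil => simp
  | cons i l ih =>
    simp [h i (by simp), ih fun j hj => h j (by simp [hj])]

theorem gauss_prodL {I : Type*} (F : I → I → R) (hF : Alt F) (l : List I)
    (h : ∀ i ∈ l, ∀ j ∈ l, F i j = 0) : gauss (bil F) hF.bil (prodL l) = prodL l := by
  induction l with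
  | nil => simpa using gauss_algebraMap (bil F) hF.bil 1
  | cons i l ih =>
    rw [prodL_cons, gauss_ι_mul, ih fun i hi j hj => h i (by simp [hi]) j (by simp [hj]),
      ctr_prodL_zero, add_zero]
    intro j hj
    rw [bil_bs]; exact h i (by simp) j (by simp [hj])

theorem Gen_prodL (L : ℕ) (l : List ℕ) (h : ∀ a ∈ l, a < L) :
    Gen L (prodL (l.map Sum.inl) : ExteriorAlgebra R (W R)) := by
  induction l with
  | nil => simpa using Gen.alg (L := L) (1 : R)
  | cons i l ih =>
    rw [List.map_cons, prodL_cons]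
    refine .mul ⟨fun s hs => ?_, fun b => by simp [bs]⟩ (ih fun a ha => h a (by simp [ha]))
    have : i ≠ s := by have := h i (by simp); omega
    simp [bs, this]

theorem map_prodL_inl (T : W R →ₗ[R] W R) (l : List (ℕ ⊕ ℕ))
    (h : ∀ i ∈ l, T (bs i) = bs i) : ExteriorAlgebra.map T (prodL l) = prodL l := by
  induction l with
  | nil => simp
  | cons i l ih => simp [h i (by simp), ih fun j hj => h j (by simp [hj])]

theorem eps_ctrK_map (T : W R →ₗ[R] W R) (K : List ℕ) (x : ExteriorAlgebra R (W R)) :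
    eps (ctrK co K (ExteriorAlgebra.map T x)) = eps (ctrK (fun k => co k ∘ₗ T) K x) := by
  induction K generalizing x with
  | nil => simp [ctrK, eps_map]
  | cons k K ih => simp only [ctrK, LinearMap.comp_apply]; rw [ctr_map, ih]

theorem ctrK_gauss (f) (B) (hB) (K : List ℕ) (x : ExteriorAlgebra R (W R)) :
    ctrK f K (gauss B hB x) = gauss B hB (ctrK f K x) := by
  induction K generalizing x with
  | nil => rfl
  | cons k K ih => simp only [ctrK, LinearMap.comp_apply]; rw [← gauss_ctr, ih]

theorem inv_ctrK (f) (K : List ℕ) (x : ExteriorAlgebra R (W R)) :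
    inv (ctrK f K x) = (-1 : R) ^ K.length • ctrK f K (inv x) := by
  induction K generalizing x with
  | nil => simp [ctrK]
  | cons k K ih =>
    simp only [ctrK, LinearMap.comp_apply]; rw [ih, inv_ctr]; simp [pow_succ]

theorem co_TT (gA hA : ℕ → ℕ → R) (h0 : ∀ a s, a < s → hA a s = 0) (k : ℕ) :
    co k ∘ₗ TT hA = - bil (blk gA hA) (bs (.inr k)) := by
  refine dual_ext (fun a => ?_) (fun a => ?_)
  · simp only [LinearMap.comp_apply, TT_inl, map_sum, map_smul, LinearMap.neg_apply, bil_bs, blk,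
      neg_neg]
    simp only [co, bs, Finsupp.lapply_apply, Finsupp.single_apply, Sum.inl.injEq, smul_eq_mul,
      mul_ite, mul_one, mul_zero, Finset.sum_ite_eq', Finset.mem_range]
    split_ifs with h
    · rfl
    · exact (h0 a k (by omega)).symm
  · simp [blk]; simp [co, bs]

theorem cK (gA hA : ℕ → ℕ → R) (ha : Alt gA) (h0 : ∀ a s, a < s → hA a s = 0)
    (K : List ℕ) (x : ExteriorAlgebra R (W R)) (hx : ExteriorAlgebra.map pp x = x)
    (hp : inv x = (-1 : R) ^ K.length • x) :
    pfE (bil (blk gA 0)) (ha.blk 0).bil (ctrK (fun k => co k ∘ₗ TT hA) K x) =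
      pfE (bil (blk gA hA)) (ha.blk hA).bil (x * prodL (K.reverse.map Sum.inr)) := by
  induction K generalizing x with
  | nil =>
    simp only [ctrK, LinearMap.id_apply, List.reverse_nil, List.map_nil, prodL_nil, mul_one]
    conv_rhs => rw [← hx, pfE_apply]
    have hb : bil (blk gA 0) = (bil (blk gA hA)).compl₁₂ pp pp := by
      refine bil_ext ?_
      rintro (a | a) (b | b) <;> simp [blk]
    rw [gauss_map (bil (blk gA hA)) (ha.blk hA).bil pp (bil (blk gA 0)) (ha.blk 0).bil
      (fun x y => by rw [hb]; rfl), eps_map]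
    rfl
  | cons k K ih =>
    have hcp : (co k ∘ₗ TT hA) ∘ₗ pp = co k ∘ₗ TT hA := by
      rw [co_TT gA hA h0]
      refine dual_ext (fun a => ?_) (fun a => ?_) <;> simp [blk]
    simp only [ctrK, LinearMap.comp_apply]
    rw [ih]
    · simp only [List.reverse_cons, List.map_append, List.map_cons, List.map_nil, prodL_append,
        prodL_cons, prodL_nil, mul_one]
      rw [← mul_assoc]
      have hodd : inv (x * prodL (K.reverse.map Sum.inr)) = -(x * prodL (K.reverse.map Sum.inr)) := by
        rw [map_mul, hp, inv_prodL]
        simp only [List.length_cons, List.length_map, List.length_reverse, smul_mul_assoc,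
          mul_smul_comm, smul_smul]
        rw [pow_succ, ← mul_assoc, ← mul_pow]
        simp
      have hc := ι_mul_comm (bs (.inr k) : W R) (x * prodL (K.reverse.map Sum.inr))
      rw [hodd, neg_mul] at hc
      have hc' := neg_eq_iff_eq_neg.mpr hc
      rw [← hc', map_neg, pfE_ι_mul, ctr_mul_of_zero, co_TT gA hA h0, ctr_neg_dual]
      · simp
      · refine ctr_prodL_zero _ _ fun i hi => ?_
        obtain ⟨j, -, rfl⟩ := List.mem_map.1 hi
        simp [blk]
    · conv_rhs => rw [← hx, ctr_map, hcp]
    · rw [inv_ctr, hp]; simp [pow_succ]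

theorem Sp_TT (hA : ℕ → ℕ → R) (L : ℕ) (v : W R) (hv : Sp L v) : Sp L (TT hA v) := by
  have hs : v = ∑ i ∈ v.support, v i • bs i := by
    conv_lhs => rw [← Finsupp.sum_single v]
    simp [Finsupp.sum, bs]
  have hi : ∀ i ∈ v.support, ∃ a, a < L ∧ i = .inl a := by
    intro i hi
    rw [Finsupp.mem_support_iff] at hi
    cases i with
    | inl a =>
      refine ⟨a, ?_, rfl⟩
      by_contra h
      exact hi (hv.1 a (by omega))
    | inr b => exact absurd (hv.2 b) hi
  rw [hs]
  refine ⟨fun s hs => ?_, fun b => ?_⟩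
  · simp only [map_sum, map_smul, Finsupp.finsetSum_apply, Finsupp.smul_apply]
    refine Finset.sum_eq_zero fun i h => ?_
    obtain ⟨a, ha, rfl⟩ := hi i h
    simp only [TT_inl, Finsupp.finsetSum_apply, Finsupp.smul_apply]
    rw [Finset.sum_eq_zero, smul_zero]
    intro t ht
    have : t ≠ s := by have := Finset.mem_range.1 ht; omega
    simp [bs, this]
  · simp only [map_sum, map_smul, Finsupp.finsetSum_apply, Finsupp.smul_apply]
    refine Finset.sum_eq_zero fun i h => ?_
    obtain ⟨a, ha, rfl⟩ := hi i h
    rw [TT_inl]; simp [bs]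

theorem pfL_main [Algebra ℚ R] (gA hA gC hC : ℕ → ℕ → R) (ha : Alt gA) (hc : Alt gC)
    (h0 : ∀ a s, a < s → hA a s = 0) (L : ℕ) (l m : List ℕ) (hl : ∀ a ∈ l, a < L) :
    pfL (blk (gI gA hA gC) (hI hA hC)) ((gI_alt ha hc).blk _) (l.map Sum.inl ++ m.map Sum.inr) =
      subSum (desc L) fun K => if Even (l.length + K.length) then
        pfL (blk gA hA) (ha.blk _) (l.map Sum.inl ++ K.reverse.map Sum.inr) *
        pfL (blk gC hC) (hc.blk _) (K.map Sum.inl ++ m.map Sum.inr) else 0 := by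
  have hT : ∀ x, ((bil (blk gC hC)).compl₁₂ (TT hA) (TT hA)) x x = 0 := fun x => (hc.blk hC).bil _
  set x : ExteriorAlgebra R (W R) := prodL (l.map Sum.inl) with hxd
  set y : ExteriorAlgebra R (W R) := prodL (m.map Sum.inr) with hyd
  have e1 : pfL (blk (gI gA hA gC) (hI hA hC)) ((gI_alt ha hc).blk _)
      (l.map Sum.inl ++ m.map Sum.inr) =
      pfE (bil (blk gC hC)) (hc.blk _).bil
        (ExteriorAlgebra.map (TT hA) (gauss (bil (blk gA 0)) (ha.blk 0).bil x) * y) := by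
    have hy : ExteriorAlgebra.map (TT hA) y = y := by
      refine map_prodL_inl _ _ fun i hi => ?_
      obtain ⟨j, -, rfl⟩ := List.mem_map.1 hi
      simp
    have hg : gauss (bil (blk gA 0)) (ha.blk 0).bil (x * y) =
        gauss (bil (blk gA 0)) (ha.blk 0).bil x * y := by
      refine gauss_mul _ _ _ _ ?_ ?_
      · refine gauss_prodL _ (ha.blk 0) _ fun i hi j hj => ?_
        obtain ⟨i, -, rfl⟩ := List.mem_map.1 hi
        obtain ⟨j, -, rfl⟩ := List.mem_map.1 hj
        rfl
      · intro v
        refine ctr_prodL_zero _ _ fun i hi => ?_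
        obtain ⟨i, -, rfl⟩ := List.mem_map.1 hi
        have : (bil (blk gA 0)).flip (bs (.inr i)) = 0 := by
          refine dual_ext (fun a => ?_) (fun a => ?_) <;> simp [blk]
        exact congrArg (fun d => d v) this
    conv_rhs => rw [← hy, ← map_mul, ← hg, pfE_apply,
      gauss_map (bil (blk gC hC)) (hc.blk _).bil (TT hA) _ hT (fun _ _ => rfl), eps_map,
      gauss_gauss (bil (blk gA 0)) (ha.blk 0).bil _ hT _ ((gI_alt ha hc).blk _).bil
        (bil_gI gA hA gC hC)]
    rw [pfL, prodL_append, pfE_apply]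
  rw [e1]
  have hG : Gen L (ExteriorAlgebra.map (TT hA) (gauss (bil (blk gA 0)) (ha.blk 0).bil x)) :=
    ((Gen_prodL L l hl).gauss _ _).map _ (Sp_TT hA L)
  set X := ExteriorAlgebra.map (TT hA) (gauss (bil (blk gA 0)) (ha.blk 0).bil x) with hX
  have e2 := congrArg (fun z => pfE (bil (blk gC hC)) (hc.blk _).bil (z * y)) (expand L X hG)
  rw [e2]
  have e3 := map_subSum (((pfE (bil (blk gC hC)) (hc.blk _).bil).toAddMonoidHom).comp
    (AddMonoidHom.mulRight y)) (desc L)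
      (fun K => eps (ctrK co K X) • prodL (R := R) (K.map Sum.inl))
  simp only [AddMonoidHom.comp_apply, AddMonoidHom.coe_mulRight,
    LinearMap.toAddMonoidHom_coe] at e3
  rw [e3]
  refine subSum_congr _ _ _ fun K hK => ?_
  rw [smul_mul_assoc, map_smul, smul_eq_mul, hX, eps_ctrK_map, ctrK_gauss, ← pfE_apply]
  have hix : inv x = (-1 : R) ^ l.length • x := by
    rw [hxd, inv_prodL, List.length_map]
  split_ifs with hev
  · congr 1
    · rw [cK gA hA ha h0]
      · rw [pfL, prodL_append]
      · refine map_prodL_inl _ _ fun i hi => ?_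
        obtain ⟨j, -, rfl⟩ := List.mem_map.1 hi
        simp
      · rw [hix]
        congr 1
        rcases Nat.even_or_odd l.length with h | h
        · rw [h.neg_one_pow, ((Nat.even_add.1 hev).1 h).neg_one_pow]
        · have : Odd K.length := by
            rw [← Nat.not_even_iff_odd] at h ⊢
            exact fun h' => h ((Nat.even_add.1 hev).2 h')
          rw [h.neg_one_pow, this.neg_one_pow]
    · rw [pfL, prodL_append]
  · rw [pfE_odd, zero_mul]
    rw [inv_ctrK, hix, map_smul, smul_smul, ← pow_add, add_comm,
      (Nat.not_even_iff_odd.1 hev).neg_one_pow, neg_one_smul]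

end
end JP

namespace JP

open ExteriorAlgebra (ι ιMulti)

section
variable {R : Type*} [CommRing R] 

theorem ctr_ιMulti {M : Type*} [AddCommGroup M] [Module R M] (d : Module.Dual R M) (n : ℕ)
    (v : Fin (n + 1) → M) :
    ctr d (ιMulti R (n + 1) v) =
      ∑ k : Fin (n + 1), ((-1 : R) ^ (k : ℕ) * d (v k)) • ιMulti R n (fun j => v (k.succAbove j)) := by
  induction n with
  | zero =>
    rw [ExteriorAlgebra.ιMulti_succ_apply, ctr_ι_mul]
    simp
  | succ n ih =>
    rw [ExteriorAlgebra.ιMulti_succ_apply, ctr_ι_mul, ih, Finset.mul_sum,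
      sub_eq_add_neg, ← Finset.sum_neg_distrib]
    conv_rhs => rw [Fin.sum_univ_succ]
    congr 1
    · simp; rfl
    · refine Finset.sum_congr rfl fun k _ => ?_
      rw [ExteriorAlgebra.ιMulti_succ_apply (fun j => v (k.succ.succAbove j))]
      simp only [Matrix.vecTail, Function.comp_def, Fin.succ_succAbove_succ,
        Fin.succ_succAbove_zero, Fin.val_succ, pow_succ, mul_smul_comm]
      simp

/-- lift a permutation fixing `0` -/
def lift1 {n : ℕ} (τ : Equiv.Perm (Fin n)) : Equiv.Perm (Fin (n + 1)) :=
  Equiv.Perm.decomposeFin.symm (0, τ)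

@[simp] theorem lift1_zero {n : ℕ} (τ : Equiv.Perm (Fin n)) : lift1 τ 0 = 0 := by
  simp [lift1]

@[simp] theorem lift1_succ {n : ℕ} (τ : Equiv.Perm (Fin n)) (i : Fin n) :
    lift1 τ i.succ = (τ i).succ := by
  simp [lift1]

@[simp] theorem sign_lift1 {n : ℕ} (τ : Equiv.Perm (Fin n)) :
    Equiv.Perm.sign (lift1 τ) = Equiv.Perm.sign τ := by
  simp [lift1]

def sg {n : ℕ} (σ : Equiv.Perm (Fin n)) : R := ((Equiv.Perm.sign σ : ℤˣ) : ℤ)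

theorem sg_mul {n : ℕ} (σ τ : Equiv.Perm (Fin n)) : (sg (σ * τ) : R) = sg σ * sg τ := by
  simp [sg]

theorem sg_lift1 {n : ℕ} (τ : Equiv.Perm (Fin n)) : (sg (lift1 τ) : R) = sg τ := by
  simp [sg]

theorem sg_sq {n : ℕ} (τ : Equiv.Perm (Fin n)) : (sg τ : R) * sg τ = 1 := by
  rcases Int.units_eq_one_or (Equiv.Perm.sign τ) with h | h <;> simp [sg, h]

variable {I : Type*} 

def PfS (F : I → I → R) (m : ℕ) (w : Fin (2 * m) → I) : R :=
  ∑ σ : Equiv.Perm (Fin (2 * m)), sg σ *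
    ∏ t : Fin m, F (w (σ ⟨2 * t.1, by omega⟩)) (w (σ ⟨2 * t.1 + 1, by omega⟩))

noncomputable def GG (F : I → I → R) (hF : Alt F) (n : ℕ) (w : Fin n → I) : R :=
  pfE (bil F) hF.bil (ιMulti R n (fun i => bs (w i)))

theorem GG_perm (F : I → I → R) (hF : Alt F) (n : ℕ) (w : Fin n → I) (σ : Equiv.Perm (Fin n)) :
    GG F hF n (fun i => w (σ i)) = sg σ * GG F hF n w := by
  have := (ιMulti R n).map_perm (fun i => bs (R := R) (w i)) σ
  unfold GG
  simp only [Function.comp_def] at this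
  rw [this]
  rcases Int.units_eq_one_or (Equiv.Perm.sign σ) with h | h <;> simp [sg, h]

theorem GG_expand (F : I → I → R) (hF : Alt F) (n : ℕ) (w : Fin (n + 2) → I) :
    GG F hF (n + 2) w = ∑ k : Fin (n + 1), (-1 : R) ^ (k : ℕ) * F (w 0) (w k.succ) *
      GG F hF n (fun j => w (k.succAbove j).succ) := by
  unfold GG
  rw [ExteriorAlgebra.ιMulti_succ_apply, pfE_ι_mul, ctr_ιMulti, map_sum]
  refine Finset.sum_congr rfl fun k _ => ?_
  rw [map_smul, smul_eq_mul]
  simp [Matrix.vecTail]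

theorem GG_sum (F : I → I → R) (hF : Alt F) (n : ℕ) (w : Fin (n + 2) → I) :
    ((n + 2).factorial : R) * GG F hF (n + 2) w = (n + 1 : ℕ) *
      ∑ σ : Equiv.Perm (Fin (n + 2)), sg σ * (F (w (σ 0)) (w (σ 1)) *
        GG F hF n (fun j => w (σ j.succ.succ))) := by
  have h1 : ((n + 2).factorial : R) * GG F hF (n + 2) w =
      ∑ σ : Equiv.Perm (Fin (n + 2)), sg σ * GG F hF (n + 2) (fun i => w (σ i)) := by
    simp_rw [GG_perm, ← mul_assoc, sg_sq, one_mul]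
    simp [Fintype.card_perm]
  rw [h1]
  simp_rw [GG_expand, Finset.mul_sum]
  rw [Finset.sum_comm]
  have h2 : ∀ k : Fin (n + 1), ∑ σ : Equiv.Perm (Fin (n + 2)), sg σ *
      ((-1 : R) ^ (k : ℕ) * F (w (σ 0)) (w (σ k.succ)) *
        GG F hF n (fun j => w (σ (k.succAbove j).succ))) =
      ∑ σ : Equiv.Perm (Fin (n + 2)), sg σ * (F (w (σ 0)) (w (σ 1)) *
        GG F hF n (fun j => w (σ j.succ.succ))) := by
    intro k
    symm
    rw [← Equiv.sum_comp (Equiv.mulRight (lift1 (k.cycleRange)⁻¹))]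
    refine Finset.sum_congr rfl fun σ _ => ?_
    have hs : (sg (lift1 (k.cycleRange)⁻¹) : R) = (-1) ^ (k : ℕ) := by
      rw [sg_lift1, sg]; simp [Fin.sign_cycleRange]
    have h1 : lift1 (k.cycleRange)⁻¹ (1 : Fin (n + 2)) = k.succ := by
      have := lift1_succ (k.cycleRange)⁻¹ 0
      rw [Fin.succ_zero_eq_one] at this
      rw [this]
      congr 1
      exact Fin.cycleRange_symm_zero k
    have h2 : ∀ j : Fin n, lift1 (k.cycleRange)⁻¹ j.succ.succ = (k.succAbove j).succ := by
      intro j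
      rw [lift1_succ]
      congr 1
      exact Fin.cycleRange_symm_succ k j
    simp only [Equiv.coe_mulRight, sg_mul, Equiv.Perm.mul_apply, lift1_zero, h1, h2, hs]
    ring
  simp_rw [h2]
  simp [Finset.mul_sum]

theorem PfS_succ (F : I → I → R) (m : ℕ) (w : Fin (2 * (m + 1)) → I) :
    ∑ σ : Equiv.Perm (Fin (2 * m + 2)), sg σ * (F (w (σ 0)) (w (σ 1)) *
        PfS F m (fun j => w (σ j.succ.succ))) = ((2 * m).factorial : R) * PfS F (m + 1) w := by
  unfold PfS
  simp_rw [Finset.mul_sum]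
  rw [Finset.sum_comm]
  have h2 : ∀ τ : Equiv.Perm (Fin (2 * m)), ∑ σ : Equiv.Perm (Fin (2 * m + 2)), sg σ *
      (F (w (σ 0)) (w (σ 1)) * (sg τ * ∏ t : Fin m,
        F (w (σ (τ ⟨2 * t.1, by omega⟩).succ.succ)) (w (σ (τ ⟨2 * t.1 + 1, by omega⟩).succ.succ)))) =
      ∑ σ : Equiv.Perm (Fin (2 * (m + 1))), (sg σ : R) *
    ∏ t : Fin (m + 1), F (w (σ ⟨2 * t.1, by omega⟩)) (w (σ ⟨2 * t.1 + 1, by omega⟩)) := by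
    intro τ
    symm
    refine (Equiv.sum_comp (Equiv.mulRight
      (lift1 (lift1 τ) : Equiv.Perm (Fin (2 * (m + 1))))) _).symm.trans ?_
    refine Finset.sum_congr rfl fun (σ : Equiv.Perm (Fin (2 * (m + 1)))) _ => ?_
    rw [Fin.prod_univ_succ]
    have h0 : lift1 (lift1 τ) (0 : Fin (2 * m + 2)) = 0 := lift1_zero _
    have h1 : lift1 (lift1 τ) (1 : Fin (2 * m + 2)) = 1 := by
      have := lift1_succ (lift1 τ) 0
      simpa using this
    have e0 : ((Equiv.mulRight (lift1 (lift1 τ) : Equiv.Perm (Fin (2 * (m + 1))))) σ)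
        ⟨2 * (0 : Fin (m + 1)).1, by simp⟩ = σ (0 : Fin (2 * m + 2)) := congrArg σ h0
    have e1 : ((Equiv.mulRight (lift1 (lift1 τ) : Equiv.Perm (Fin (2 * (m + 1))))) σ)
        ⟨2 * (0 : Fin (m + 1)).1 + 1, by simp⟩ = σ (1 : Fin (2 * m + 2)) := congrArg σ h1
    have hss : (sg ((Equiv.mulRight (lift1 (lift1 τ) : Equiv.Perm (Fin (2 * (m + 1))))) σ) : R)
        = sg σ * sg τ := by
      have : (sg (lift1 (lift1 τ)) : R) = sg τ := by rw [sg_lift1, sg_lift1]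
      rw [← this]
      exact sg_mul _ _
    have e2 : ∀ i : Fin (2 * m), ((Equiv.mulRight
        (lift1 (lift1 τ) : Equiv.Perm (Fin (2 * (m + 1))))) σ)
        ((i.succ.succ : Fin (2 * m + 2))) = σ ((τ i).succ.succ : Fin (2 * m + 2)) := by
      intro i
      have hh : lift1 (lift1 τ) i.succ.succ = (τ i).succ.succ := by rw [lift1_succ, lift1_succ]
      exact congrArg σ hh
    rw [e0, e1, hss]
    have e3 : ∏ t : Fin m, F (w (((Equiv.mulRight
        (lift1 (lift1 τ) : Equiv.Perm (Fin (2 * (m + 1))))) σ) ⟨2 * t.succ.1, by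
          change 2 * t.succ.1 < 2 * (m + 1); have := t.succ.2; omega⟩))
        (w (((Equiv.mulRight
        (lift1 (lift1 τ) : Equiv.Perm (Fin (2 * (m + 1))))) σ) ⟨2 * t.succ.1 + 1, by
          change 2 * t.succ.1 + 1 < 2 * (m + 1); have := t.succ.2; omega⟩)) =
        ∏ t : Fin m,
        F (w (σ (τ ⟨2 * t.1, by omega⟩).succ.succ)) (w (σ (τ ⟨2 * t.1 + 1, by omega⟩).succ.succ)) := by
      refine Finset.prod_congr rfl fun t _ => ?_
      exact congrArg₂ F (congrArg w (e2 ⟨2 * t.1, by omega⟩))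
        (congrArg w (e2 ⟨2 * t.1 + 1, by omega⟩))
    rw [e3]
    ring
  simp_rw [h2]
  simp [Fintype.card_perm, Finset.mul_sum]

theorem GG_eq [Algebra ℚ R] (F : I → I → R) (hF : Alt F) (m : ℕ) (w : Fin (2 * m) → I) :
    ((2 : ℚ) ^ m * m.factorial) • GG F hF (2 * m) w = PfS F m w := by
  induction m with
  | zero => simp [GG, PfS, sg]
  | succ m ih =>
    have h1 := GG_sum F hF (2 * m) w
    have h2 := PfS_succ F m w
    simp_rw [← ih] at h2
    have h3 : ((2 : ℚ) ^ m * m.factorial) • ∑ σ : Equiv.Perm (Fin (2 * m + 2)),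
        (sg σ * (F (w (σ 0)) (w (σ 1)) * GG F hF (2 * m) (fun j => w (σ j.succ.succ)))) =
        ((2 * m).factorial : R) * PfS F (m + 1) w := by
      rw [← h2, Finset.smul_sum]
      refine Finset.sum_congr rfl fun σ _ => ?_
      rw [mul_smul_comm, mul_smul_comm]
    have h4 : ((2 : ℚ) ^ m * m.factorial) • (((2 * m + 2).factorial : R) *
        GG F hF (2 * m + 2) w) = ((2 * m + 1 : ℕ) : R) * (((2 * m).factorial : R) *
          PfS F (m + 1) w) := by
      rw [h1, ← h3, mul_smul_comm]
    have c1 : ∀ (n : ℕ) (x : R), (n : R) * x = (n : ℚ) • x := by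
      intro n x; simp [Algebra.smul_def]
    simp only [c1, smul_smul] at h4
    have hne : ((2 * m + 1).factorial : ℚ) ≠ 0 := by positivity
    have h5 := congrArg (fun y => (((2 * m + 1).factorial : ℚ))⁻¹ • y) h4
    simp only [smul_smul] at h5
    have e1 : (((2 * m + 1).factorial : ℚ))⁻¹ * (((2 * m + 1 : ℕ) : ℚ) * (2 * m).factorial) = 1 := by
      rw [Nat.factorial_succ] at hne ⊢
      push_cast at hne ⊢
      exact inv_mul_cancel₀ hne
    rw [e1, one_smul] at h5
    rw [← h5]
    change _ • GG F hF (2 * m + 2) w = _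
    congr 1
    rw [Nat.factorial_succ (2 * m + 1), Nat.factorial_succ m, pow_succ]
    push_cast at hne ⊢
    field_simp
    ring

theorem Pf_eq [Algebra ℚ R] (F : I → I → R) (hF : Alt F) (N : ℕ) (hN : Even N) (w : Fin N → I)
    (B : Matrix (Fin N) (Fin N) R) (hB : ∀ i j, B i j = F (w i) (w j)) :
    Pf B = pfL F hF (List.ofFn w) := by
  obtain ⟨m, rfl⟩ := hN.two_dvd
  have h := GG_eq F hF m w
  have e : (2 * m) / 2 = m := by omega
  have hG : GG F hF (2 * m) w = pfL F hF (List.ofFn w) := by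
    unfold GG pfL prodL
    rw [ExteriorAlgebra.ιMulti_apply, List.map_ofFn]
    rfl
  have hne : ((2 : ℚ) ^ m * m.factorial) ≠ 0 := by positivity
  rw [← hG]
  have : GG F hF (2 * m) w = ((2 : ℚ) ^ m * m.factorial)⁻¹ • PfS F m w := by
    rw [← h, smul_smul, inv_mul_cancel₀ hne, one_smul]
  rw [this]
  unfold Pf PfS
  simp only [hB]
  congr 1
  · rw [e]
  refine Finset.sum_congr rfl fun σ _ => ?_
  rw [zsmul_eq_mul]
  congr 1
  refine Finset.prod_bij' (fun t _ => (⟨t.1, by have := Finset.mem_range.1 t.2; omega⟩ : Fin m))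
    (fun t _ => ⟨t.1, by have := t.2; simp⟩) ?_ ?_ ?_ ?_ ?_ <;> simp

/-- vanishing by a Hall type obstruction -/
theorem Pf_zero [Algebra ℚ R] {N : ℕ} (hN : Even N) (B : Matrix (Fin N) (Fin N) R)
    (S T : Finset (Fin N)) (hc : T.card < S.card)
    (h1 : ∀ s ∈ S, ∀ j, j ∉ T → B s j = 0) (h2 : ∀ s ∈ S, ∀ j, j ∉ T → B j s = 0) :
    Pf B = 0 := by
  unfold Pf
  rw [Finset.sum_eq_zero, smul_zero]
  intro σ _
  by_contra hne
  have hp : ∀ t ∈ (Finset.range (N / 2)).attach, B (σ ⟨2 * t.1, by have := Finset.mem_range.mp t.2; omega⟩)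
            (σ ⟨2 * t.1 + 1, by have := Finset.mem_range.mp t.2; omega⟩) ≠ 0 := by
    intro t ht h0
    exact hne (by rw [Finset.prod_eq_zero ht h0, smul_zero])
  let par : Fin N → Fin N := fun p => ⟨if p.1 % 2 = 0 then p.1 + 1 else p.1 - 1, by
    have := p.2; have := hN.two_dvd; split_ifs <;> omega⟩
  have hpar : ∀ p, par (par p) = p := by
    intro p; apply Fin.ext; simp only [par]; split_ifs <;> omega
  have hpne : ∀ p : Fin N, B (σ p) (σ (par p)) ≠ 0 ∨ B (σ (par p)) (σ p) ≠ 0 := by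
    intro p
    have hlt : p.1 / 2 < N / 2 := by have := p.2; have := hN.two_dvd; omega
    have := hp ⟨p.1 / 2, Finset.mem_range.2 hlt⟩ (Finset.mem_attach _ _)
    by_cases h : p.1 % 2 = 0
    · left
      convert this using 3
      · apply Fin.ext; simp; omega
      · apply Fin.ext; simp [par, h]; omega
    · right
      convert this using 3
      · apply Fin.ext; simp [par, h]; omega
      · apply Fin.ext; simp; omega
  let f : Fin N → Fin N := fun s => σ (par (σ.symm s))
  have hinj : Function.Injective f := by
    intro a b hab
    have := σ.injective hab
    have := congrArg par this
    rw [hpar, hpar] at this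
    exact σ.symm.injective this
  have hmaps : ∀ s ∈ S, f s ∈ T := by
    intro s hs
    by_contra hT
    have := hpne (σ.symm s)
    rw [Equiv.apply_symm_apply] at this
    rcases this with h | h
    · exact h (h1 s hs _ hT)
    · exact h (h2 s hs _ hT)
  have := Finset.card_le_card_of_injOn f hmaps hinj.injOn
  omega

theorem map_Pf {S : Type*} [CommRing S] [Algebra ℚ S] [Algebra ℚ R] (f : R →+* S) {N : ℕ}
    (B : Matrix (Fin N) (Fin N) R) : f (Pf B) = Pf (B.map f) := by
  unfold Pf
  rw [map_rat_smul f]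
  simp [map_sum, map_prod]

end
end JP

namespace JP

open ExteriorAlgebra (ι)

theorem SP_ne {s : SPartn} {i : ℕ} (h : i < s.len) : s.part i ≠ 0 := Nat.find_min s.exists_zero h

theorem SP_len (s : SPartn) : s.part s.len = 0 := Nat.find_spec s.exists_zero

theorem SP_succ (s : SPartn) (i : ℕ) : s.part (i + 1) ≤ s.part i := by
  by_cases h : s.part (i + 1) = 0
  · omega
  · exact (s.strict' i h).le

theorem SP_anti (s : SPartn) {i j : ℕ} (h : i ≤ j) : s.part j ≤ s.part i := by
  induction j, h using Nat.le_induction with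
  | base => exact le_rfl
  | succ j _ ih => exact (SP_succ s j).trans ih

theorem SP_ge {s : SPartn} {i : ℕ} (h : s.len ≤ i) : s.part i = 0 := by
  have := SP_anti s h
  rw [SP_len] at this
  omega

theorem SP_ext {s t : SPartn} (h : ∀ i, s.part i = t.part i) : s = t := by
  cases s; cases t
  simp only [SPartn.mk.injEq]
  exact funext h

theorem SP_len_eq {s : SPartn} {n : ℕ} (h0 : s.part n = 0) (h1 : ∀ i < n, s.part i ≠ 0) :
    s.len = n := (Nat.find_eq_iff s.exists_zero).2 ⟨h0, fun i hi => h1 i hi⟩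

/-- the first `m` parts -/
def pl (s : SPartn) (m : ℕ) : List ℕ := (List.range m).map s.part

theorem pl_succ (s : SPartn) (m : ℕ) : pl s (m + 1) = pl s m ++ [s.part m] := by
  simp [pl, List.range_succ]

@[simp] theorem pl_length (s : SPartn) (m : ℕ) : (pl s m).length = m := by simp [pl]

theorem pl_pos {s : SPartn} {a : ℕ} (h : a ∈ pl s s.len) : 0 < a := by
  simp only [pl, List.mem_map, List.mem_range] at h
  obtain ⟨i, hi, rfl⟩ := h
  exact Nat.pos_of_ne_zero (SP_ne hi)

section
variable {R : Type*} [CommRing R]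

noncomputable def gQ (φ : SymF →+* R) (Q2 : ℕ → ℕ → SymF) (a b : ℕ) : R := φ (Q2 a b)
noncomputable def hQ (φ : SymF →+* R) (a b : ℕ) : R := φ (qZ ((a : ℤ) - b))

theorem hQ_lt (φ : SymF →+* R) {a b : ℕ} (h : a < b) : hQ φ a b = 0 := by
  unfold hQ qZ
  rw [if_neg (by omega), map_zero]

theorem hQ_self (φ : SymF →+* R) (a : ℕ) : hQ φ a a = 1 := by
  simp [hQ, qZ, qSym]

theorem hQ_add (φ : SymF →+* R) (a b c : ℕ) : hQ φ (c + a) (c + b) = hQ φ a b := by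
  unfold hQ
  congr 2
  push_cast
  ring

theorem altA (φ : SymF →+* R) : Alt (gQ φ QA2) where
  diag a := by simp [gQ, QA2]
  skew a b := by
    unfold gQ QA2
    rcases lt_trichotomy a b with h | h | h
    · simp [h, h.not_gt]
    · simp [h]
    · simp [h, h.not_gt]

theorem altC (φ : SymF →+* R) : Alt (gQ φ QC2) where
  diag a := by simp [gQ, QC2]
  skew a b := by
    unfold gQ QC2
    rcases lt_trichotomy a b with h | h | h
    · simp [h, h.not_gt]
    · simp [h]
    · simp [h, h.not_gt]

theorem gC_zero (φ : SymF →+* R) {a : ℕ} (h : 0 < a) : gQ φ QC2 0 a = - hQ φ a 0 := by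
  simp [gQ, hQ, QC2, h, QC2core, qZ, qSym]

theorem ofFn_block (l m : ℕ) (a b : SPartn) :
    List.ofFn (fun i : Fin (l + m) => if (i : ℕ) < l then (Sum.inl (a.part i) : ℕ ⊕ ℕ)
      else Sum.inr (b.part (m - 1 - ((i : ℕ) - l)))) =
      (pl a l).map Sum.inl ++ (pl b m).reverse.map Sum.inr := by
  apply List.ext_getElem
  · simp
  · intro i h1 h2
    simp only [List.getElem_ofFn]
    split_ifs with h
    · rw [List.getElem_append_left (by simpa using h)]
      simp [pl]
    · rw [List.getElem_append_right (by simpa using h)]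
      simp [pl]

theorem block_Pf [Algebra ℚ R] (g h : ℕ → ℕ → R) (hg : Alt g) (l m : ℕ) (hlm : Even (l + m))
    (a b : SPartn) (B : Matrix (Fin (l + m)) (Fin (l + m)) R)
    (hB : ∀ i j, B i j = if (i : ℕ) < l then
      if (j : ℕ) < l then g (a.part i) (a.part j)
      else h (a.part i) (b.part (m - 1 - ((j : ℕ) - l)))
    else
      if (j : ℕ) < l then - h (a.part j) (b.part (m - 1 - ((i : ℕ) - l)))
      else 0) :
    Pf B = pfL (blk g h) (hg.blk h) ((pl a l).map Sum.inl ++ (pl b m).reverse.map Sum.inr) := by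
  rw [← ofFn_block]
  refine Pf_eq _ _ _ hlm _ _ fun i j => ?_
  rw [hB]
  split_ifs <;> rfl

theorem map_skewQ [Algebra ℚ R] (φ : SymF →+* R) (Q2 : ℕ → ℕ → SymF) (hg : Alt (gQ φ Q2))
    (lam mu : SPartn) (m : ℕ) (hm1 : mu.len ≤ m) (hm2 : m ≤ mu.len + 1)
    (hpar : Even (lam.len + m)) :
    φ (skewQ Q2 lam mu) = pfL (blk (gQ φ Q2) (hQ φ)) (hg.blk _)
      ((pl lam lam.len).map Sum.inl ++ (pl mu m).reverse.map Sum.inr) := by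
  have hm : (if Even (lam.len + mu.len) then mu.len else mu.len + 1) = m := by
    split_ifs with h
    · rw [Nat.even_iff] at *; omega
    · rw [Nat.even_iff] at *; omega
  subst hm
  unfold skewQ
  rw [map_Pf]
  refine block_Pf (gQ φ Q2) (hQ φ) hg _ _ hpar lam mu _ fun i j => ?_
  simp only [Matrix.map_apply, Matrix.of_apply, gQ, hQ, dite_eq_ite]
  by_cases hi : (i : ℕ) < lam.len <;> by_cases hj : (j : ℕ) < lam.len <;>
    simp only [hi, hj, if_true, if_false, map_neg, map_zero]

theorem skewQ_zero (Q2 : ℕ → ℕ → SymF) (lam mu : SPartn) (h : ¬ mu.Sub lam) :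
    skewQ Q2 lam mu = 0 := by
  unfold SPartn.Sub at h
  push Not at h
  obtain ⟨i, hi⟩ := h
  have him : i < mu.len := by
    by_contra hc
    rw [SP_ge (not_lt.1 hc)] at hi
    omega
  unfold skewQ
  extract_lets l m
  have hm : mu.len ≤ m := by simp only [m]; split_ifs <;> omega
  have hpar : Even (l + m) := by
    simp only [m, l]; split_ifs with h <;> rw [Nat.even_iff] at * <;> omega
  have hz : ∀ j p, i ≤ j → p ≤ i → qZ ((lam.part j : ℤ) - mu.part p) = 0 := by
    intro j p hj hp
    have := SP_anti lam hj
    have := SP_anti mu hp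
    unfold qZ
    rw [if_neg (by omega)]
  refine Pf_zero hpar _ (Finset.univ.filter fun s : Fin (l + m) => l + (m - 1 - i) ≤ s.1)
    (Finset.univ.filter fun s : Fin (l + m) => s.1 < l ∧ s.1 < i) ?_ ?_ ?_
  · refine lt_of_le_of_lt (b := i) ?_ (Nat.lt_of_succ_le ?_)
    · have := Finset.card_le_card_of_injOn (s := (Finset.univ.filter fun s : Fin (l + m) => s.1 < l ∧ s.1 < i))
        (t := Finset.range i) (fun s => s.1) (by intro s hs; simp at hs ⊢; exact hs.2)
        (Fin.val_injective.injOn)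
      simpa using this
    · have := Finset.card_le_card_of_injOn (s := (Finset.univ : Finset (Fin (i + 1))))
        (t := (Finset.univ.filter fun s : Fin (l + m) => l + (m - 1 - i) ≤ s.1))
        (fun p => ⟨l + (m - 1 - i) + p.1, by have := p.2; omega⟩)
        (by intro s hs; simp)
        (by intro s _ t _ hst; simp at hst; exact Fin.ext hst)
      simpa using this
  · intro s hs j hj
    simp only [Finset.mem_filter, Finset.mem_univ, true_and, not_and, not_lt] at hs hj
    have : ¬ s.1 < l := by omega
    simp only [Matrix.of_apply, this, dif_neg, not_false_eq_true]
    split_ifs with h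
    · rw [hz _ _ (hj h) (by omega), neg_zero]
    · rfl
  · intro s hs j hj
    simp only [Finset.mem_filter, Finset.mem_univ, true_and, not_and, not_lt] at hs hj
    have : ¬ s.1 < l := by omega
    simp only [Matrix.of_apply, this, dif_neg, not_false_eq_true]
    split_ifs with h
    · rw [hz _ _ (hj h) (by omega)]
    · rfl

theorem pf_mid (B : LinearMap.BilinForm R (W R)) (hB : ∀ x, B x x = 0) (X : List (ℕ ⊕ ℕ))
    (w : W R) (y : ExteriorAlgebra R (W R)) (hX : ∀ i ∈ X, B w (bs i) = 0) :
    pfE B hB (prodL X * (ι R w * y)) = pfE B hB (prodL X * ctr (B w) y) := by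
  have h1 : ctr (B w) (prodL X * y) = (-1 : R) ^ X.length • (prodL X * ctr (B w) y) := by
    induction X with
    | nil => simp
    | cons i X ih =>
      rw [prodL_cons, mul_assoc, ctr_ι_mul, ih fun j hj => hX j (List.mem_cons_of_mem _ hj),
        hX i List.mem_cons_self]
      simp [pow_succ, mul_assoc]
  have h2 : prodL X * (ι R w * y) = (-1 : R) ^ X.length • (ι R w * (prodL X * y)) := by
    rw [← mul_assoc (ι R w), ι_mul_comm w (prodL X), inv_prodL, smul_mul_assoc, smul_mul_assoc, smul_smul,
      ← mul_pow]
    simp [mul_assoc]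
  rw [h2, map_smul, pfE_ι_mul, h1, map_smul, smul_smul, ← mul_pow]
  simp

theorem pl_inl_kill (φ : SymF →+* R) (X Y : List ℕ) (hX : ∀ a ∈ X, 0 < a) (hY : ∀ a ∈ Y, 0 < a) :
    ∀ i ∈ X.map Sum.inl ++ Y.map Sum.inr,
      bil (blk (gQ φ QC2) (hQ φ)) (bs (.inl 0) - bs (.inr 0)) (bs i) = 0 := by
  intro i hi
  simp only [List.mem_append, List.mem_map] at hi
  rw [map_sub, LinearMap.sub_apply, bil_bs, bil_bs]
  rcases hi with ⟨a, ha, rfl⟩ | ⟨a, ha, rfl⟩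
  · simp [blk, gC_zero φ (hX a ha)]
  · simp [blk, hQ_lt φ (hY a ha)]

theorem map_skewC [Algebra ℚ R] (φ : SymF →+* R)
    (nu mu : SPartn) (m : ℕ) (hm1 : mu.len ≤ m) (hm2 : m ≤ mu.len + 1) (m0 : ℕ)
    (hm0 : m0 = if Even (nu.len + m) then nu.len else nu.len + 1) :
    φ (QCskew nu mu) = pfL (blk (gQ φ QC2) (hQ φ)) ((altC φ).blk _)
      ((pl nu m0).map Sum.inl ++ (pl mu m).reverse.map Sum.inr) := by
  unfold QCskew
  split_ifs at hm0 with h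
  · subst hm0
    exact map_skewQ φ QC2 (altC φ) nu mu m hm1 hm2 h
  subst hm0
  have kill := pl_inl_kill φ (pl nu nu.len) (pl mu mu.len).reverse (fun a => pl_pos)
    (fun a ha => pl_pos (List.mem_reverse.1 ha))
  have e0 : (bs (.inl 0) : W R) = (bs (.inl 0) - bs (.inr 0)) + bs (.inr 0) := by abel
  have hz := SP_len
  rcases (by omega : m = mu.len ∨ m = mu.len + 1) with rfl | rfl
  · rw [map_skewQ φ QC2 (altC φ) nu mu (mu.len + 1) (by omega) le_rfl
      (by rw [Nat.even_iff] at *; omega), pl_succ, pl_succ, hz, hz]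
    unfold pfL
    simp only [List.map_append, List.reverse_append, List.map_cons, List.map_nil, prodL_append,
      List.reverse_cons, List.reverse_nil, List.nil_append, prodL_cons, prodL_nil, mul_one,
      mul_assoc]
    rw [e0, map_add, add_mul, mul_add, map_add, pf_mid _ _ _ (bs (Sum.inl 0) - bs (Sum.inr 0)), ctr_prodL_zero]
    · simp
    · exact fun i hi => kill i (List.mem_append_right _ hi)
    · exact fun i hi => kill i (List.mem_append_left _ hi)
  · rw [map_skewQ φ QC2 (altC φ) nu mu mu.len (by omega) (by omega)
      (by rw [Nat.even_iff] at *; omega), pl_succ, pl_succ, hz, hz]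
    unfold pfL
    simp only [List.map_append, List.reverse_append, List.map_cons, List.map_nil, prodL_append,
      List.reverse_cons, List.reverse_nil, List.nil_append, prodL_cons, prodL_nil, mul_one,
      mul_assoc]
    rw [e0, map_add, add_mul, ι_mul_self, add_zero, pf_mid, ctr_ι_mul, ctr_prodL_zero]
    · simp [blk, hQ_self]
    · exact fun i hi => kill i (List.mem_append_right _ hi)
    · exact fun i hi => kill i (List.mem_append_left _ hi)

theorem pfL_pair {I : Type*} (F : I → I → R) (hF : Alt F) (i j : I) : pfL F hF [i, j] = F i j := by
  unfold pfL
  rw [prodL_cons, pfE_ι_mul, prodL_cons, ctr_ι_mul]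
  simp

end
end JP

namespace JP

theorem desc_succ (L : ℕ) : desc (L + 1) = (desc L).map (· + 1) ++ [0] := by
  induction L with
  | zero => rfl
  | succ L ih =>
    have h : desc (L + 1 + 1) = (L + 1) :: desc (L + 1) := rfl
    rw [h]
    conv_lhs => rw [ih]
    rfl

theorem desc_pairwise (L : ℕ) : (desc L).Pairwise (· > ·) := by
  induction L with
  | zero => simp [desc]
  | succ L ih =>
    rw [desc, List.pairwise_cons]
    exact ⟨fun a ha => mem_desc.1 ha, ih⟩

/-- `[L, ..., 1]` -/
def dsc1 (L : ℕ) : List ℕ := (desc L).map (· + 1)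

theorem mem_dsc1 {L a : ℕ} : a ∈ dsc1 L ↔ 0 < a ∧ a ≤ L := by
  simp only [dsc1, List.mem_map, mem_desc]
  constructor
  · rintro ⟨b, hb, rfl⟩; omega
  · rintro ⟨h1, h2⟩; exact ⟨a - 1, by omega, by omega⟩

theorem dsc1_pairwise (L : ℕ) : (dsc1 L).Pairwise (· > ·) := by
  rw [dsc1, List.pairwise_map]
  exact (desc_pairwise L).imp (by intro a b h; omega)

theorem subSum_append_zero {R : Type*} [AddCommMonoid R] (J : List ℕ) (F : List ℕ → R) :
    subSum (J ++ [0]) F = subSum J (fun K => F K + F (K ++ [0])) := by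
  induction J generalizing F with
  | nil => rfl
  | cons j J ih => simp only [List.cons_append, subSum, ih]

theorem subSum_eq {R : Type*} [AddCommMonoid R] (J : List ℕ) (F : List ℕ → R) :
    subSum J F = (J.sublists'.map F).sum := by
  induction J generalizing F with
  | nil => simp [subSum]
  | cons j J ih => simp [subSum, ih, Function.comp_def]

open scoped Classical in
noncomputable def toS (K : List ℕ) : SPartn :=
  if h : K.Pairwise (· > ·) then
    ⟨fun i => K.getD i 0, by
      intro i hi
      have h1 : i + 1 < K.length := by
        by_contra hc
        exact hi (List.getD_eq_default _ _ (not_lt.1 hc))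
      rw [List.getD_eq_getElem _ _ h1, List.getD_eq_getElem _ _ (by omega)]
      exact List.pairwise_iff_getElem.1 h i (i + 1) (by omega) h1 (by omega),
     ⟨K.length, List.getD_eq_default _ _ le_rfl⟩⟩
  else SPartn.empty

theorem toS_part {K : List ℕ} (h : K.Pairwise (· > ·)) (i : ℕ) : (toS K).part i = K.getD i 0 := by
  simp [toS, h]

theorem toS_len {K : List ℕ} (h : K.Pairwise (· > ·)) (h0 : ∀ a ∈ K, 0 < a) :
    (toS K).len = K.length := by
  refine SP_len_eq ?_ ?_
  · rw [toS_part h, List.getD_eq_default _ _ le_rfl]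
  · intro i hi
    rw [toS_part h, List.getD_eq_getElem _ _ hi]
    exact (h0 _ (List.getElem_mem hi)).ne'

theorem pl_toS {K : List ℕ} (h : K.Pairwise (· > ·)) : pl (toS K) K.length = K := by
  apply List.ext_getElem
  · simp
  · intro i h1 h2
    simp [pl, toS_part h, h2]

theorem pl_pairwise (s : SPartn) : (pl s s.len).Pairwise (· > ·) := by
  rw [List.pairwise_iff_getElem]
  intro i j hi hj hij
  simp only [pl, List.getElem_map, List.getElem_range]
  exact s.part_lt hij (by simpa using hj)

theorem toS_pl (s : SPartn) : toS (pl s s.len) = s := by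
  refine SP_ext fun i => ?_
  rw [toS_part (pl_pairwise s)]
  by_cases h : i < s.len
  · rw [List.getD_eq_getElem _ _ (by simpa using h)]
    simp [pl]
  · rw [List.getD_eq_default _ _ (by simpa using h), SP_ge (not_lt.1 h)]

theorem pl_sublist (s : SPartn) (L : ℕ) (h : s.part 0 ≤ L) : (pl s s.len).Sublist (dsc1 L) := by
  refine List.sublist_of_subperm_of_pairwise (r := (· > ·)) ?_ (pl_pairwise s) (dsc1_pairwise L)
  refine List.subperm_of_subset ((pl_pairwise s).imp (fun h => h.ne')) ?_
  intro a ha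
  refine mem_dsc1.2 ⟨pl_pos ha, ?_⟩
  simp only [pl, List.mem_map, List.mem_range] at ha
  obtain ⟨i, _, rfl⟩ := ha
  exact (SP_anti s (Nat.zero_le i)).trans h

theorem finsum_subSum {R : Type*} [AddCommMonoid R] (L : ℕ) (G : SPartn → R)
    (hG : ∀ s : SPartn, L < s.part 0 → G s = 0) :
    ∑ᶠ s, G s = subSum (dsc1 L) (fun K => G (toS K)) := by
  classical
  have hnd : (dsc1 L).sublists'.Nodup :=
    List.nodup_sublists'.2 ((dsc1_pairwise L).imp (fun h => h.ne'))
  have hK : ∀ K ∈ (dsc1 L).sublists', K.Pairwise (· > ·) ∧ ∀ a ∈ K, 0 < a := by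
    intro K hK
    have := List.mem_sublists'.1 hK
    exact ⟨(dsc1_pairwise L).sublist this, fun a ha => (mem_dsc1.1 (this.subset ha)).1⟩
  rw [subSum_eq, ← List.sum_toFinset _ hnd]
  rw [finsum_eq_sum_of_support_subset (s := (dsc1 L).sublists'.toFinset.image toS) G, Finset.sum_image]
  · intro K1 h1 K2 h2 e
    have a1 := hK K1 (List.mem_toFinset.1 h1)
    have a2 := hK K2 (List.mem_toFinset.1 h2)
    rw [← pl_toS a1.1, ← pl_toS a2.1, ← toS_len a1.1 a1.2, ← toS_len a2.1 a2.2, e]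
  · intro s hs
    have hL : s.part 0 ≤ L := by
      by_contra hc
      exact hs (hG s (not_le.1 hc))
    simp only [Finset.coe_image, Set.mem_image, Finset.mem_coe, List.mem_toFinset,
      List.mem_sublists']
    exact ⟨pl s s.len, pl_sublist s L hL, toS_pl s⟩

section
variable {R : Type*} [CommRing R] [Algebra ℚ R]

theorem main_abs (φA φC : SymF →+* R) (lam mu : SPartn) (m : ℕ)
    (hm1 : mu.len ≤ m) (hm2 : m ≤ mu.len + 1) (hpar : Even (lam.len + m)) :
    ∑ᶠ (ν : SPartn) (_ : mu.Sub ν ∧ ν.Sub lam), φC (QCskew ν mu) * φA (QAskew lam ν) =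
    pfL (blk (gI (gQ φA QA2) (hQ φA) (gQ φC QC2)) (hI (hQ φA) (hQ φC)))
      ((gI_alt (altA φA) (altC φC)).blk _)
      ((pl lam lam.len).map Sum.inl ++ (pl mu m).reverse.map Sum.inr) := by
  classical
  rw [pfL_main (gQ φA QA2) (hQ φA) (gQ φC QC2) (hQ φC) (altA φA) (altC φC)
    (fun a s h => hQ_lt φA h) (lam.part 0 + 1)]
  swap
  · intro a ha
    simp only [pl, List.mem_map, List.mem_range] at ha
    obtain ⟨i, _, rfl⟩ := ha
    exact Nat.lt_succ_of_le (SP_anti lam (Nat.zero_le i))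
  have h1 : ∀ ν : SPartn, (∑ᶠ (_ : mu.Sub ν ∧ ν.Sub lam), φC (QCskew ν mu) * φA (QAskew lam ν)) =
      φC (QCskew ν mu) * φA (QAskew lam ν) := by
    intro ν
    rw [finsum_eq_if]
    split_ifs with h
    · rfl
    · rw [not_and_or] at h
      rcases h with h | h
      · rw [QCskew, skewQ_zero _ _ _ h, map_zero, zero_mul]
      · rw [QAskew, skewQ_zero _ _ _ h, map_zero, mul_zero]
  simp_rw [h1]
  rw [finsum_subSum (lam.part 0), desc_succ, subSum_append_zero]
  · refine subSum_congr _ _ _ fun K hK => ?_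
    have hp : K.Pairwise (· > ·) := (dsc1_pairwise _).sublist hK
    have h0 : ∀ a ∈ K, 0 < a := fun a ha => (mem_dsc1.1 (hK.subset ha)).1
    have hl := toS_len hp h0
    have e1 : pl (toS K) (toS K).len = K := by rw [hl, pl_toS hp]
    have e2 : pl (toS K) ((toS K).len + 1) = K ++ [0] := by rw [pl_succ, e1, SP_len]
    generalize toS K = ν at *
    simp only [pl_length, List.length_append, List.length_singleton, ← hl]
    by_cases h : Even (lam.len + ν.len)
    · have h' : ¬ Even (lam.len + (ν.len + 1)) := by rw [Nat.even_iff] at *; omega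
      rw [if_pos h, if_neg h', add_zero, QAskew,
        map_skewQ φA QA2 (altA φA) lam ν ν.len le_rfl (by omega) h,
        map_skewC φC ν mu m hm1 hm2 ν.len (by
          rw [if_pos]; rw [Nat.even_iff] at *; omega), e1, mul_comm]
    · have h' : Even (lam.len + (ν.len + 1)) := by rw [Nat.even_iff] at *; omega
      rw [if_neg h, if_pos h', zero_add, QAskew,
        map_skewQ φA QA2 (altA φA) lam ν (ν.len + 1) (by omega) (by omega) h',
        map_skewC φC ν mu m hm1 hm2 (ν.len + 1) (by
          rw [if_neg]; rw [Nat.even_iff] at *; omega), e2, mul_comm]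
  · intro s hs
    rw [QAskew, skewQ_zero _ lam s, map_zero, mul_zero]
    intro hc
    exact absurd (hc 0) (not_le.2 hs)

theorem hI_lt (φA φC : SymF →+* R) {a b : ℕ} (h : a < b) : hI (hQ φA) (hQ φC) a b = 0 := by
  refine Finset.sum_eq_zero fun s hs => ?_
  rw [Finset.mem_range] at hs
  rw [hQ_lt φC (by omega), mul_zero]

theorem hI_shift (φA φC : SymF →+* R) (b c : ℕ) :
    hI (hQ φA) (hQ φC) (b + c) b = hI (hQ φA) (hQ φC) c 0 := by
  unfold hI
  rw [add_assoc, Finset.sum_range_add, Finset.sum_eq_zero, zero_add]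
  · refine Finset.sum_congr rfl fun s _ => ?_
    rw [hQ_add]
    congr 1
    exact hQ_add φC s 0 b
  · intro s hs
    rw [Finset.mem_range] at hs
    rw [hQ_lt φC (by omega), mul_zero]

theorem hI_zero (φA φC : SymF →+* R) : hI (hQ φA) (hQ φC) 0 0 = 1 := by
  simp [hI, hQ_self]

end

theorem interQ_eq (k n : ℕ) (lam mu : SPartn) (m : ℕ)
    (hm1 : mu.len ≤ m) (hm2 : m ≤ mu.len + 1) (hpar : Even (lam.len + m)) :
    interQ k n lam mu =
    pfL (blk (gI (gQ (piAupper k n).toRingHom QA2) (hQ (piAupper k n).toRingHom)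
        (gQ ((MvPolynomial.C (σ := Fin (n - k))).comp (piC k).toRingHom) QC2))
      (hI (hQ (piAupper k n).toRingHom)
        (hQ ((MvPolynomial.C (σ := Fin (n - k))).comp (piC k).toRingHom))))
      ((gI_alt (altA _) (altC _)).blk _)
      ((pl lam lam.len).map Sum.inl ++ (pl mu m).reverse.map Sum.inr) :=
  main_abs (piAupper k n).toRingHom
    ((MvPolynomial.C (σ := Fin (n - k))).comp (piC k).toRingHom) lam mu m hm1 hm2 hpar

theorem empty_len : SPartn.empty.len = 0 := SP_len_eq rfl (by simp)

theorem single_len {a : ℕ} (h : 0 < a) : (SPartn.single a).len = 1 :=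
  SP_len_eq rfl (by intro i hi; simp [SPartn.single]; omega)

theorem two_len {a b : ℕ} (h : b < a) (hb : 0 < b) : (SPartn.two a b h).len = 2 :=
  SP_len_eq rfl (by
    intro i hi
    rcases (by omega : i = 0 ∨ i = 1) with rfl | rfl <;> simp [SPartn.two] <;> omega)

theorem interQ_two (k n a b : ℕ) (h : b < a) (hb : 0 < b) :
    interQ k n (SPartn.two a b h) SPartn.empty =
      gI (gQ (piAupper k n).toRingHom QA2) (hQ (piAupper k n).toRingHom)
        (gQ ((MvPolynomial.C (σ := Fin (n - k))).comp (piC k).toRingHom) QC2) a b := by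
  rw [interQ_eq k n _ _ 0 (by simp [empty_len]) (by omega) (by simp [two_len h hb]), two_len h hb]
  have : (pl (SPartn.two a b h) 2).map Sum.inl ++ (pl SPartn.empty 0).reverse.map Sum.inr =
    [(Sum.inl a : ℕ ⊕ ℕ), Sum.inl b] := rfl
  rw [this, pfL_pair]
  rfl

theorem interQrowZ_eq (k n a b : ℕ) :
    interQrowZ k n ((a : ℤ) - b) = hI (hQ (piAupper k n).toRingHom)
        (hQ ((MvPolynomial.C (σ := Fin (n - k))).comp (piC k).toRingHom)) a b := by
  unfold interQrowZ
  split_ifs with h1 h2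
  · rw [hI_lt _ _ (by omega)]
  · have : a = b + 0 := by omega
    rw [this, hI_shift, hI_zero]
  · obtain ⟨c, rfl⟩ := Nat.exists_eq_add_of_le (by omega : b ≤ a)
    have hc : 0 < c := by omega
    have e : (((b + c : ℕ) : ℤ) - b).toNat = c := by omega
    rw [e, hI_shift, interQ_eq k n _ _ 1 (by simp [empty_len]) (by simp)
      (by simp [single_len hc]), single_len hc]
    have : (pl (SPartn.single c) 1).map Sum.inl ++ (pl SPartn.empty 1).reverse.map Sum.inr =
      [(Sum.inl c : ℕ ⊕ ℕ), Sum.inr 0] := rfl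
    rw [this, pfL_pair]
    rfl

end JP

/-- The Józefiak–Pragacz-type Pfaffian formula for intermediate symplectic
`Q`-polynomials:
`Q^{(k,n−k)}_{λ/μ} = Pf [[M^I_λ, N^I_{λ,μ}], [−(N^I_{λ,μ})ᵀ, O]]`, where
`M^I_λ = [Q^{(k,n−k)}_{(λ_i,λ_j)}]` and `N^I_{λ,μ} = [Q^{(k,n−k)}_{(λ_i−μ_{m+1−j})}]`.
Here `μ` is allowed `m` parts with `μ_m ≥ 0`, i.e. `m = ℓ(μ)` or `ℓ(μ) + 1`,
and `ℓ(λ) + m` is even. -/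
theorem interQ_pfaffian (k n : ℕ) (hkn : k ≤ n) (lam mu : SPartn)
    (hl : 2 ≤ lam.len) (hln : lam.len ≤ n) (hsub : mu.Sub lam)
    (m : ℕ) (hm1 : mu.len ≤ m) (hm2 : m ≤ mu.len + 1)
    (hpar : Even (lam.len + m)) :
    interQ k n lam mu =
      Pf (N := lam.len + m) (Matrix.of fun i j =>
        if hi : (i : ℕ) < lam.len then
          if hj : (j : ℕ) < lam.len then
            (if hij : (i : ℕ) < (j : ℕ) then
              interQ k n (SPartn.two (lam.part i) (lam.part j) (lam.part_lt hij hj))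
                SPartn.empty
            else if hji : (j : ℕ) < (i : ℕ) then
              - interQ k n (SPartn.two (lam.part j) (lam.part i) (lam.part_lt hji hi))
                SPartn.empty
            else 0)
          else interQrowZ k n ((lam.part i : ℤ) - mu.part (m - 1 - ((j : ℕ) - lam.len)))
        else
          if hj : (j : ℕ) < lam.len then
            - interQrowZ k n ((lam.part j : ℤ) - mu.part (m - 1 - ((i : ℕ) - lam.len)))
          else 0) := by
  rw [JP.interQ_eq k n lam mu m hm1 hm2 hpar]
  symm
  refine JP.block_Pf _ _ (JP.gI_alt (JP.altA _) (JP.altC _)) _ _ hpar lam mu _ fun i j => ?_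
  have hpos : ∀ i : ℕ, i < lam.len → 0 < lam.part i := fun i hi =>
    Nat.pos_of_ne_zero (JP.SP_ne hi)
  rw [Matrix.of_apply]
  by_cases hi : (i : ℕ) < lam.len
  · by_cases hj : (j : ℕ) < lam.len
    · rw [dif_pos hi, dif_pos hj, if_pos hi, if_pos hj]
      rcases lt_trichotomy (i : ℕ) (j : ℕ) with h | h | h
      · rw [dif_pos h, JP.interQ_two _ _ _ _ _ (hpos _ hj)]
      · rw [dif_neg (by omega), dif_neg (by omega), h]
        exact ((JP.gI_alt (JP.altA _) (JP.altC _)).diag _).symm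
      · rw [dif_neg (by omega), dif_pos h, JP.interQ_two _ _ _ _ _ (hpos _ hi)]
        exact ((JP.gI_alt (JP.altA _) (JP.altC _)).skew _ _).symm
    · rw [dif_pos hi, dif_neg hj, if_pos hi, if_neg hj, JP.interQrowZ_eq]
  · by_cases hj : (j : ℕ) < lam.len
    · rw [dif_neg hi, dif_pos hj, if_neg hi, if_pos hj, JP.interQrowZ_eq]
    · rw [dif_neg hi, dif_neg hj, if_neg hi, if_neg hj]

end
end
end
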